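/- arXiv:2006.04447 — 4 statements merged into one kernel-verified Lean document; each statement's English description precedes it below -/
import Mathlib

section
/- Let f : 𝔸 → 𝔸 be a positive twist map that preserves the Lebesgue measure Leb, and let z₀ ∈ 𝔸 be such that (i) z₀ has over-conjugate points, and (ii) z₀ has an open neighborhood U with Leb(⋃_{n∈ℤ} fⁿ(U)) < +∞. Then there exists an open neighborhood W ⊆ U of z₀ such that for Leb-almost every z ∈ W the asymptotic torsion Torsion(f,z) exists and Torsion(f,z) < 0. -/
noncomputable section

open MeasureTheory Set Filter Topology Function

/-- The annulus `𝔸 = (ℝ/ℤ) × ℝ`. -/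
abbrev Ann : Type := AddCircle (1 : ℝ) × ℝ

/-- The plane `ℝ²`, universal cover of the annulus. -/
abbrev Pl : Type := ℝ × ℝ

/-- The covering projection `π : ℝ² → 𝔸`, `π(x,y) = (x + ℤ, y)`. -/
def pr : Pl → Ann := fun p => ((p.1 : AddCircle (1 : ℝ)), p.2)

/-- The vertical vector `v = (0,1)`. -/
def vv : Pl := (0, 1)

/-- Data of a `C¹` diffeomorphism `f` of the annulus, isotopic to the identity,
presented through a lifted isotopy `(Ft t)_{t ∈ [0,1]}` of `C¹` diffeomorphisms of the
plane commuting with the deck transformation, with `Ft 0 = id` and `Ft 1` a lift of `f`,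
whose derivatives depend continuously on `(t, z)`. -/
structure IsotopySetup where
  f : Ann → Ann
  Ft : ℝ → Pl → Pl
  lift_f : ∀ p, pr (Ft 1 p) = f (pr p)
  Ft_zero : Ft 0 = id
  Ft_periodic : ∀ t, ∀ p : Pl, Ft t (p + (1, 0)) = Ft t p + (1, 0)
  Ft_smooth : ∀ t ∈ Icc (0:ℝ) 1, ContDiff ℝ 1 (Ft t)
  Ft_diffeo : ∀ t ∈ Icc (0:ℝ) 1, ∃ G : Pl → Pl, ContDiff ℝ 1 G ∧
      Function.LeftInverse G (Ft t) ∧ Function.RightInverse G (Ft t)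
  Ft_cont : ContinuousOn (fun q : ℝ × Pl => Ft q.1 q.2) (Icc (0:ℝ) 1 ×ˢ univ)
  DFt_cont : ContinuousOn (fun q : ℝ × Pl => fderiv ℝ (Ft q.1) q.2) (Icc (0:ℝ) 1 ×ˢ univ)

namespace IsotopySetup

variable (S : IsotopySetup)

/-- The canonical lift `F : ℝ² → ℝ²` of `f`. -/
def F : Pl → Pl := S.Ft 1

/-- The extended linearized isotopy: for `t ≥ 0`, `D t p` is the derivative at `p` of the
extended isotopy `f_t`, determined by `Df_{n+s} = Df_s ∘ Df^n` for `n ∈ ℕ`, `s ∈ [0,1)`. -/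
def D (t : ℝ) (p : Pl) : Pl →L[ℝ] Pl :=
  (fderiv ℝ (S.Ft (Int.fract t)) (S.F^[⌊t⌋₊] p)).comp (fderiv ℝ (S.F^[⌊t⌋₊]) p)

/-- `S.AngleVar p w n a` : the total angular variation on `[0,n]` of the vector `w ∈ T_{π(p)}𝔸`
under the extended linearized isotopy equals `a`; that is, `a = n·Torsionₙ(f, π(p), w)`.
Here `Θ` is a continuous lift of the angle `≺(v, Df_t(z)w)` (so that the direction of
`Df_t(z)w` is `(−sin(2πΘ(t)), cos(2πΘ(t)))`). -/
def AngleVar (p w : Pl) (n : ℕ) (a : ℝ) : Prop :=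
  ∃ Θ : ℝ → ℝ, ContinuousOn Θ (Icc 0 (n:ℝ)) ∧
    (∀ t ∈ Icc (0:ℝ) (n:ℝ), ∃ r : ℝ, 0 < r ∧
      S.D t p w = r • (-Real.sin (2 * Real.pi * Θ t), Real.cos (2 * Real.pi * Θ t))) ∧
    a = Θ n - Θ 0

/-- `S.TorsionFin p w n τ` : the finite-time torsion `Torsionₙ(f, π(p), w)` equals `τ`. -/
def TorsionFin (p w : Pl) (n : ℕ) (τ : ℝ) : Prop :=
  ∃ a : ℝ, S.AngleVar p w n a ∧ τ = a / n

/-- The asymptotic torsion at the lifted point `p` exists and equals `L`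
(for every choice of nonzero tangent vector `w`). -/
def TorsionLift (p : Pl) (L : ℝ) : Prop :=
  ∀ w : Pl, w ≠ 0 → ∃ a : ℕ → ℝ, (∀ n : ℕ, 1 ≤ n → S.AngleVar p w n (a n)) ∧
    Tendsto (fun n : ℕ => a n / (n : ℝ)) atTop (nhds L)

/-- The asymptotic torsion at `z ∈ 𝔸` exists and equals `L`. -/
def Torsion (z : Ann) (L : ℝ) : Prop :=
  ∃ p : Pl, pr p = z ∧ S.TorsionLift p L

open Classical in
/-- The asymptotic torsion as a function on the annulus (defaulting to `0` where undefined). -/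
def torsionFun (z : Ann) : ℝ :=
  if h : ∃ L, S.Torsion z L then h.choose else 0

/-- The lifted point `p` has conjugate points: `n·Torsionₙ(f,z,v) = −k/2` for some `n,k ≥ 1`. -/
def ConjLift (p : Pl) : Prop :=
  ∃ n k : ℕ, 1 ≤ n ∧ 1 ≤ k ∧ ∃ a : ℝ, S.AngleVar p vv n a ∧ a = -(k : ℝ) / 2

/-- The lifted point `p` has over-conjugate points: `n·Torsionₙ(f,z,v) < −1/2` for some `n ≥ 1`. -/
def OverConjLift (p : Pl) : Prop :=
  ∃ n : ℕ, 1 ≤ n ∧ ∃ a : ℝ, S.AngleVar p vv n a ∧ a < -(1:ℝ) / 2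

/-- The point `z ∈ 𝔸` has conjugate points. -/
def Conj (z : Ann) : Prop := ∃ p : Pl, pr p = z ∧ S.ConjLift p

/-- The point `z ∈ 𝔸` has over-conjugate points. -/
def OverConj (z : Ann) : Prop := ∃ p : Pl, pr p = z ∧ S.OverConjLift p

/-- `f` is a positive twist map: for every `x`, the map `y ↦ p₁(F(x,y))` is an increasing
diffeomorphism of `ℝ` onto `ℝ`. -/
def PosTwist : Prop :=
  ∀ x : ℝ, StrictMono (fun y => (S.F (x, y)).1) ∧
    Function.Surjective (fun y => (S.F (x, y)).1) ∧
    ∀ y : ℝ, 0 < deriv (fun y => (S.F (x, y)).1) y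

/-- `f` has no conjugate points (linearized-dynamics formulation): for every `z ∈ ℝ²` and
`n ≥ 1`, the first component of `DFⁿ(z)(0,1)` does not vanish. -/
def NoConjPts : Prop :=
  ∀ p : Pl, ∀ n : ℕ, 1 ≤ n → ((fderiv ℝ (S.F^[n]) p) (0, 1)).1 ≠ 0

/-- `f` is exact symplectic: it preserves the Lebesgue measure and `F*(y dx) − y dx = dS`
for a `C¹` function `S : ℝ² → ℝ` with `S(x+1,y) = S(x,y)`. -/
def ExactSymplectic : Prop :=
  MeasurePreserving S.f volume volume ∧
  ∃ Sg : Pl → ℝ, ContDiff ℝ 1 Sg ∧ (∀ p : Pl, Sg (p + (1, 0)) = Sg p) ∧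
    ∀ p : Pl,
      fderiv ℝ Sg p (1, 0) = (S.F p).2 * (fderiv ℝ S.F p (1, 0)).1 - p.2 ∧
      fderiv ℝ Sg p (0, 1) = (S.F p).2 * (fderiv ℝ S.F p (0, 1)).1

end IsotopySetup

/-- `γ` is an essential curve of the annulus: a topological embedding of the circle which is
not homotopic to a constant map. -/
def EssentialCurve (γ : C(AddCircle (1:ℝ), Ann)) : Prop :=
  Topology.IsEmbedding γ ∧ ∀ z : Ann, ¬ γ.Homotopic (ContinuousMap.const _ z)

/-- An open subset of the annulus is essential if it contains an essential curve. -/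
def EssentialSet (U : Set Ann) : Prop :=
  ∃ γ : C(AddCircle (1:ℝ), Ann), EssentialCurve γ ∧ range γ ⊆ U

/-- `f` restricted to `U` is `C⁰`-integrable: `U` is the disjoint union of a family of
`f`-invariant images of essential curves. -/
def C0IntegrableOn (f : Ann → Ann) (U : Set Ann) : Prop :=
  ∃ (ι : Type) (γ : ι → C(AddCircle (1:ℝ), Ann)),
    (∀ i, EssentialCurve (γ i) ∧ f '' range (γ i) = range (γ i)) ∧
    (⋃ i, range (γ i)) = U ∧
    Pairwise (Disjoint on fun i => range (γ i))

/-- `ℤ`-iterates of a bijection (negative iterates through the inverse map). -/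
def iterZ {α : Type*} [Nonempty α] (f : α → α) : ℤ → α → α
  | Int.ofNat n => f^[n]
  | Int.negSucc n => (Function.invFun f)^[n + 1]

/-- `ℐ(f)`: the union of all `f`-invariant essential curves. -/
def invCurveUnion (f : Ann → Ann) : Set Ann :=
  ⋃ γ ∈ {γ : C(AddCircle (1:ℝ), Ann) | EssentialCurve γ ∧ f '' range γ = range γ}, range γ

def uu (θ : ℝ) : Pl := (-Real.sin (2 * Real.pi * θ), Real.cos (2 * Real.pi * θ))

lemma uu_continuous : Continuous uu := by unfold uu; fun_prop

lemma uu_ne_zero (θ : ℝ) : uu θ ≠ 0 := by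
  intro h
  have h1 : -Real.sin (2 * Real.pi * θ) = 0 := congrArg Prod.fst h
  have h2 : Real.cos (2 * Real.pi * θ) = 0 := congrArg Prod.snd h
  have := Real.sin_sq_add_cos_sq (2 * Real.pi * θ)
  rw [h2, neg_eq_zero.mp h1] at this
  norm_num at this

lemma uu_half (θ : ℝ) : uu (θ + 1/2) = - uu θ := by
  unfold uu
  have : 2 * Real.pi * (θ + 1/2) = 2 * Real.pi * θ + Real.pi := by ring
  rw [this, Real.sin_add_pi, Real.cos_add_pi]; rfl

lemma uu_zero : uu 0 = vv := by simp [uu, vv]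

/-- complex coordinate -/
def cc (w : Pl) : ℂ := ⟨w.2, -w.1⟩

lemma cc_continuous : Continuous cc := by
  have : cc = fun w : Pl => ((w.2 : ℂ) + (-w.1 : ℝ) * Complex.I) := by
    funext w; apply Complex.ext <;> simp [cc]
  rw [this]; fun_prop

lemma cc_ne_zero {w : Pl} (h : w ≠ 0) : cc w ≠ 0 := by
  intro h'
  apply h
  have h1 := congrArg Complex.re h'
  have h2 := congrArg Complex.im h'
  simp [cc] at h1 h2
  exact Prod.ext h2 h1

lemma cc_inj {w w' : Pl} (h : cc w = cc w') : w = w' := by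
  have h1 := congrArg Complex.re h
  have h2 := congrArg Complex.im h
  simp [cc] at h1 h2
  exact Prod.ext h2 h1

lemma exp_eq_cc (z : ℂ) : Complex.exp z = cc (Real.exp z.re • uu (z.im / (2 * Real.pi))) := by
  have hp : 2 * Real.pi * (z.im / (2 * Real.pi)) = z.im := by
    field_simp
  apply Complex.ext
  · simp [cc, uu, hp, Complex.exp_re]
  · simp [cc, uu, hp, Complex.exp_im]

lemma exists_polar {w : Pl} (h : w ≠ 0) : ∃ r : ℝ, 0 < r ∧ ∃ θ, w = r • uu θ := by
  refine ⟨Real.exp (Complex.log (cc w)).re, Real.exp_pos _, (Complex.log (cc w)).im / (2 * Real.pi), ?_⟩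
  apply cc_inj
  rw [← exp_eq_cc, Complex.exp_log (cc_ne_zero h)]

lemma uu_eq {r r' : ℝ} (hr : 0 < r) (hr' : 0 < r') {α β : ℝ} (h : r • uu α = r' • uu β) :
    ∃ m : ℤ, α = β + m := by
  have e1 : ∀ (r α : ℝ), 0 < r → Complex.exp ⟨Real.log r, 2 * Real.pi * α⟩ = cc (r • uu α) := by
    intro r α hr
    rw [exp_eq_cc]
    simp only [Real.exp_log hr]
    congr 3
    field_simp
  have h2 := e1 r α hr
  rw [h, ← e1 r' β hr', Complex.exp_eq_exp_iff_exists_int] at h2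
  obtain ⟨n, hn⟩ := h2
  refine ⟨n, ?_⟩
  have := congrArg Complex.im hn
  simp at this
  have hpi := Real.pi_pos
  have : 2 * Real.pi * α = 2 * Real.pi * (β + n) := by rw [this]; ring
  exact mul_left_cancel₀ (by positivity) this

lemma int_const {s : Set ℝ} (hs : IsPreconnected s) {g : ℝ → ℝ} (hg : ContinuousOn g s)
    (hi : ∀ t ∈ s, ∃ m : ℤ, g t = m) {x y : ℝ} (hx : x ∈ s) (hy : y ∈ s) : g x = g y := by
  have hd : DiscreteTopology (range ((↑) : ℤ → ℝ)) :=
    Int.isClosedEmbedding_coe_real.isEmbedding.toHomeomorph.discreteTopology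
  refine hs.constant_of_mapsTo (T := range ((↑) : ℤ → ℝ)) ⟨hd⟩ hg ?_ hx hy
  intro t ht
  obtain ⟨m, hm⟩ := hi t ht
  exact ⟨m, hm.symm⟩

lemma angle_unique {s : Set ℝ} (hs : IsPreconnected s) {Θ₁ Θ₂ : ℝ → ℝ} {V : ℝ → Pl}
    (h1 : ContinuousOn Θ₁ s) (h2 : ContinuousOn Θ₂ s)
    (hv1 : ∀ t ∈ s, ∃ r : ℝ, 0 < r ∧ V t = r • uu (Θ₁ t))
    (hv2 : ∀ t ∈ s, ∃ r : ℝ, 0 < r ∧ V t = r • uu (Θ₂ t))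
    {x y : ℝ} (hx : x ∈ s) (hy : y ∈ s) : Θ₁ x - Θ₁ y = Θ₂ x - Θ₂ y := by
  have := int_const hs (h1.sub h2) (fun t ht => by
    obtain ⟨r, hr, e⟩ := hv1 t ht
    obtain ⟨r', hr', e'⟩ := hv2 t ht
    obtain ⟨m, hm⟩ := uu_eq hr hr' (e.symm.trans e')
    exact ⟨m, by simp [hm]⟩) hx hy
  simp only [Pi.sub_apply] at this
  linarith

namespace IsotopySetup
variable (S : IsotopySetup)

lemma deriv_inj {t : ℝ} (ht : t ∈ Icc (0:ℝ) 1) (p : Pl) {w : Pl} (hw : w ≠ 0) :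
    fderiv ℝ (S.Ft t) p w ≠ 0 := by
  intro h0
  obtain ⟨G, hG, hl, -⟩ := S.Ft_diffeo t ht
  have hd : DifferentiableAt ℝ (S.Ft t) p := (S.Ft_smooth t ht).differentiable (by norm_num) p
  have hdG : DifferentiableAt ℝ G (S.Ft t p) := hG.differentiable (by norm_num) _
  have h1 := fderiv_comp p hdG hd
  have h2 : G ∘ S.Ft t = id := funext hl
  rw [h2, fderiv_id] at h1
  have h3 := congrArg (fun L => L w) h1
  simp [h0] at h3
  exact hw h3

lemma exists_lift : ∃ Φ : ℝ → Pl → ℝ → ℝ,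
    ContinuousOn (fun q : ℝ × (Pl × ℝ) => Φ q.1 q.2.1 q.2.2) (Icc (0:ℝ) 1 ×ˢ univ) ∧
    (∀ p θ, Φ 0 p θ = θ) ∧
    ∀ t ∈ Icc (0:ℝ) 1, ∀ p θ, ∃ r : ℝ, 0 < r ∧ fderiv ℝ (S.Ft t) p (uu θ) = r • uu (Φ t p θ) := by
  have hc : Continuous (fun q : unitInterval × (Pl × ℝ) =>
      cc (fderiv ℝ (S.Ft q.1) q.2.1 (uu q.2.2))) := by
    apply cc_continuous.comp
    have h1 : Continuous (fun q : unitInterval × (Pl × ℝ) => fderiv ℝ (S.Ft q.1) q.2.1) := by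
      have := S.DFt_cont.comp_continuous (f := fun q : unitInterval × (Pl × ℝ) => ((q.1 : ℝ), q.2.1))
        (by fun_prop) (fun q => ⟨q.1.2, mem_univ _⟩)
      exact this
    exact h1.clm_apply (uu_continuous.comp (by fun_prop))
  let H : C(unitInterval × (Pl × ℝ), {z : ℂ // z ≠ 0}) :=
    ⟨fun q => ⟨cc (fderiv ℝ (S.Ft q.1) q.2.1 (uu q.2.2)),
      cc_ne_zero (S.deriv_inj q.1.2 _ (uu_ne_zero _))⟩, hc.subtype_mk _⟩
  let f0 : C(Pl × ℝ, ℂ) := ⟨fun a => ((2 * Real.pi * a.2 : ℝ) : ℂ) * Complex.I, by fun_prop⟩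
  have H0 : ∀ a, H (0, a) = ⟨_, (f0 a).exp_ne_zero⟩ := by
    intro a
    apply Subtype.ext
    show cc (fderiv ℝ (S.Ft ((0:unitInterval):ℝ)) a.1 (uu a.2)) = Complex.exp (f0 a)
    rw [exp_eq_cc]
    have : (((0:unitInterval):ℝ)) = 0 := rfl
    rw [this, S.Ft_zero, fderiv_id]
    simp [f0]
  let E := Complex.isCoveringMap_exp.liftHomotopy H f0 H0
  have hE : ∀ q, Complex.exp (E q) = cc (fderiv ℝ (S.Ft q.1) q.2.1 (uu q.2.2)) := fun q => by
    have := congrFun (Complex.isCoveringMap_exp.liftHomotopy_lifts H f0 H0) q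
    exact congrArg Subtype.val this
  have hE0 : ∀ a, E (0, a) = f0 a := Complex.isCoveringMap_exp.liftHomotopy_zero H f0 H0
  refine ⟨fun t p θ => (E (projIcc 0 1 zero_le_one t, (p, θ))).im / (2 * Real.pi), ?_, ?_, ?_⟩
  · apply Continuous.continuousOn
    have : Continuous (fun q : ℝ × (Pl × ℝ) => E (projIcc 0 1 zero_le_one q.1, (q.2.1, q.2.2))) :=
      E.continuous.comp ((continuous_projIcc.comp continuous_fst).prodMk (by fun_prop))
    exact (Complex.continuous_im.comp this).div_const _
  · intro p θ
    have : projIcc (0:ℝ) 1 zero_le_one 0 = 0 := projIcc_left _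
    simp only [this, hE0]
    simp [f0]
  · intro t ht p θ
    refine ⟨Real.exp (E (projIcc 0 1 zero_le_one t, (p, θ))).re, Real.exp_pos _, ?_⟩
    apply cc_inj
    rw [← exp_eq_cc, hE, projIcc_of_mem _ ht]

end IsotopySetup

namespace IsotopySetup
variable (S : IsotopySetup)

def Phi : ℝ → Pl → ℝ → ℝ := S.exists_lift.choose
lemma Phi_cont : ContinuousOn (fun q : ℝ × (Pl × ℝ) => S.Phi q.1 q.2.1 q.2.2) (Icc (0:ℝ) 1 ×ˢ univ) :=
  S.exists_lift.choose_spec.1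
lemma Phi_zero (p : Pl) (θ : ℝ) : S.Phi 0 p θ = θ := S.exists_lift.choose_spec.2.1 p θ
lemma Phi_lift {t : ℝ} (ht : t ∈ Icc (0:ℝ) 1) (p : Pl) (θ : ℝ) :
    ∃ r : ℝ, 0 < r ∧ fderiv ℝ (S.Ft t) p (uu θ) = r • uu (S.Phi t p θ) :=
  S.exists_lift.choose_spec.2.2 t ht p θ

lemma Phi_cont_t (p : Pl) (θ : ℝ) : ContinuousOn (fun t => S.Phi t p θ) (Icc 0 1) := by
  have := S.Phi_cont.comp (s := Icc (0:ℝ) 1) (f := fun t : ℝ => (t, (p, θ))) (by fun_prop)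
    (fun t ht => ⟨ht, mem_univ _⟩)
  exact this

/-- time one lift -/
def phi (p : Pl) (θ : ℝ) : ℝ := S.Phi 1 p θ

lemma phi_cont : Continuous (fun q : Pl × ℝ => S.phi q.1 q.2) := by
  have := S.Phi_cont.comp_continuous (f := fun q : Pl × ℝ => ((1:ℝ), q)) (by fun_prop)
    (fun q => ⟨by simp, mem_univ _⟩)
  exact this

lemma phi_lift (p : Pl) (θ : ℝ) :
    ∃ r : ℝ, 0 < r ∧ fderiv ℝ S.F p (uu θ) = r • uu (S.phi p θ) :=
  S.Phi_lift (by simp) p θ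

lemma phi_half (p : Pl) (θ : ℝ) : S.phi p (θ + 1/2) = S.phi p θ + 1/2 := by
  have h := angle_unique (s := Icc (0:ℝ) 1) isPreconnected_Icc
    (Θ₁ := fun t => S.Phi t p (θ + 1/2)) (Θ₂ := fun t => S.Phi t p θ + 1/2)
    (V := fun t => fderiv ℝ (S.Ft t) p (uu (θ + 1/2)))
    (S.Phi_cont_t _ _) ((S.Phi_cont_t _ _).add continuousOn_const)
    (fun t ht => S.Phi_lift ht _ _) (fun t ht => by
      obtain ⟨r, hr, e⟩ := S.Phi_lift ht p θ
      refine ⟨r, hr, ?_⟩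
      rw [uu_half, uu_half, map_neg, e, smul_neg])
    (x := 1) (y := 0) (by simp) (by simp)
  simp only [Phi_zero] at h
  unfold phi
  linarith

lemma fderiv_periodic (t : ℝ) (p : Pl) :
    fderiv ℝ (S.Ft t) (p + (1, 0)) = fderiv ℝ (S.Ft t) p := by
  have h1 : (fun q => S.Ft t (q + (1, 0))) = fun q => S.Ft t q + (1, 0) :=
    funext (S.Ft_periodic t)
  have h2 : fderiv ℝ (fun q => S.Ft t (q + (1, 0))) p = fderiv ℝ (S.Ft t) (p + (1, 0)) :=
    fderiv_comp_add_right _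
  rw [← h2, h1, fderiv_add_const]

lemma phi_periodic (p : Pl) (θ : ℝ) : S.phi (p + (1, 0)) θ = S.phi p θ := by
  have h := angle_unique (s := Icc (0:ℝ) 1) isPreconnected_Icc
    (Θ₁ := fun t => S.Phi t (p + (1,0)) θ) (Θ₂ := fun t => S.Phi t p θ)
    (V := fun t => fderiv ℝ (S.Ft t) p (uu θ))
    (S.Phi_cont_t _ _) (S.Phi_cont_t _ _)
    (fun t ht => by
      have := S.Phi_lift ht (p + (1,0)) θ
      rwa [S.fderiv_periodic] at this) (fun t ht => S.Phi_lift ht _ _)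
    (x := 1) (y := 0) (by simp) (by simp)
  simp only [Phi_zero] at h
  unfold phi
  linarith

lemma half_nat {g : ℝ → ℝ} (h : ∀ θ, g (θ + 1/2) = g θ + 1/2) (n : ℕ) (θ : ℝ) :
    g (θ + n/2) = g θ + n/2 := by
  induction n with
  | zero => simp
  | succ n ih =>
    have : θ + ((n+1:ℕ):ℝ)/2 = (θ + n/2) + 1/2 := by push_cast; ring
    rw [this, h, ih]; push_cast; ring

lemma half_int {g : ℝ → ℝ} (h : ∀ θ, g (θ + 1/2) = g θ + 1/2) (m : ℤ) (θ : ℝ) :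
    g (θ + m/2) = g θ + m/2 := by
  obtain ⟨n, rfl | rfl⟩ := m.eq_nat_or_neg
  · rw [Int.cast_natCast]; exact half_nat h n θ
  · have := half_nat h n (θ + ((-(n:ℤ) : ℤ) : ℝ)/2)
    have e : θ + ((-(n:ℤ) : ℤ) : ℝ)/2 + n/2 = θ := by push_cast; ring
    rw [e] at this
    rw [this]; push_cast; ring

lemma phi_strictMono (p : Pl) : StrictMono (S.phi p) := by
  have hc : Continuous (S.phi p) := S.phi_cont.comp (f := fun θ : ℝ => (p, θ)) (by fun_prop)
  have hinj : Injective (S.phi p) := by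
    intro α β h
    obtain ⟨r, hr, e⟩ := S.phi_lift p α
    obtain ⟨r', hr', e'⟩ := S.phi_lift p β
    rw [← h] at e'
    have e2 : fderiv ℝ S.F p (r' • uu α - r • uu β) = 0 := by
      rw [map_sub, map_smul, map_smul, e, e', smul_smul, smul_smul, mul_comm, sub_self]
    have e3 : r' • uu α = r • uu β := by
      by_contra hne
      exact S.deriv_inj (t := 1) (by simp) p (sub_ne_zero.mpr hne) e2
    obtain ⟨m, hm⟩ := uu_eq hr' hr e3
    have h4 := half_int (S.phi_half p) (2 * m) β
    have h5 : β + ((2 * m : ℤ):ℝ)/2 = α := by rw [hm]; push_cast; ring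
    rw [h5, h] at h4
    have : ((2 * m : ℤ):ℝ)/2 = 0 := by linarith
    linarith
  rcases hc.strictMono_of_inj hinj with h | h
  · exact h
  · exfalso
    have h1 := h (show (0:ℝ) < 0 + 1/2 by norm_num)
    rw [S.phi_half] at h1
    linarith

/-- iterated angle -/
def An : ℕ → Pl → ℝ → ℝ
  | 0 => fun _ θ => θ
  | n + 1 => fun p θ => S.phi (S.F^[n] p) (An n p θ)

lemma F_cont : Continuous S.F := (S.Ft_smooth 1 (by simp)).continuous

lemma An_cont (n : ℕ) : Continuous (fun q : Pl × ℝ => S.An n q.1 q.2) := by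
  induction n with
  | zero => exact continuous_snd
  | succ n ih =>
    exact S.phi_cont.comp (((S.F_cont.iterate n).comp continuous_fst).prodMk ih)

lemma An_half (n : ℕ) (p : Pl) (θ : ℝ) : S.An n p (θ + 1/2) = S.An n p θ + 1/2 := by
  induction n with
  | zero => rfl
  | succ n ih => simp only [An]; rw [ih, S.phi_half]

lemma An_strictMono (n : ℕ) (p : Pl) : StrictMono (S.An n p) := by
  induction n with
  | zero => exact strictMono_id
  | succ n ih => exact (S.phi_strictMono _).comp ih

lemma F_periodic (p : Pl) : S.F (p + (1,0)) = S.F p + (1,0) := S.Ft_periodic 1 p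

lemma Fn_periodic (n : ℕ) (p : Pl) : S.F^[n] (p + (1,0)) = S.F^[n] p + (1,0) := by
  induction n with
  | zero => rfl
  | succ n ih => rw [iterate_succ_apply', iterate_succ_apply', ih, S.F_periodic]

lemma An_periodic (n : ℕ) (p : Pl) (θ : ℝ) : S.An n (p + (1,0)) θ = S.An n p θ := by
  induction n with
  | zero => rfl
  | succ n ih => simp only [An]; rw [ih, Fn_periodic, phi_periodic]

lemma An_add (n m : ℕ) (p : Pl) (θ : ℝ) :
    S.An (n + m) p θ = S.An m (S.F^[n] p) (S.An n p θ) := by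
  induction m with
  | zero => rfl
  | succ m ih =>
    show S.phi (S.F^[n+m] p) (S.An (n+m) p θ) = S.phi (S.F^[m] (S.F^[n] p)) _
    rw [ih, add_comm n m, iterate_add_apply]

lemma F_diff : Differentiable ℝ S.F := (S.Ft_smooth 1 (by simp)).differentiable (by norm_num)

lemma An_lift (n : ℕ) (p : Pl) (θ : ℝ) :
    ∃ r : ℝ, 0 < r ∧ fderiv ℝ (S.F^[n]) p (uu θ) = r • uu (S.An n p θ) := by
  induction n with
  | zero => exact ⟨1, one_pos, by simp [An]⟩
  | succ n ih =>
    obtain ⟨r, hr, e⟩ := ih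
    obtain ⟨r', hr', e'⟩ := S.phi_lift (S.F^[n] p) (S.An n p θ)
    refine ⟨r * r', by positivity, ?_⟩
    rw [iterate_succ', fderiv_comp p (S.F_diff _) (S.F_diff.iterate n p)]
    simp only [ContinuousLinearMap.comp_apply, e, map_smul, e', smul_smul, An]

/-- continuous angle along the isotopy -/
def Th (p : Pl) (θ : ℝ) (t : ℝ) : ℝ := S.Phi (Int.fract t) (S.F^[⌊t⌋₊] p) (S.An ⌊t⌋₊ p θ)

lemma Th_nat (p : Pl) (θ : ℝ) (n : ℕ) : S.Th p θ n = S.An n p θ := by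
  simp [Th, Phi_zero]

lemma Th_cont (p : Pl) (θ : ℝ) (n : ℕ) : ContinuousOn (S.Th p θ) (Icc 0 (n:ℝ)) := by
  induction n with
  | zero => simp
  | succ n ih =>
    have h : ContinuousOn (S.Th p θ) (Icc (n:ℝ) ((n+1:ℕ):ℝ)) := by
      have h1 : ContinuousOn (fun t : ℝ => S.Phi (t - n) (S.F^[n] p) (S.An n p θ))
          (Icc (n:ℝ) ((n+1:ℕ):ℝ)) :=
        (S.Phi_cont_t _ _).comp (f := fun t : ℝ => t - n) (by fun_prop) (fun t ht => by
          have := ht.1; have := ht.2; push_cast at this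
          constructor <;> linarith)
      refine h1.congr fun t ht => ?_
      rcases eq_or_lt_of_le ht.2 with h2 | h2
      · rw [h2, Th_nat]
        simp [An, phi]
      · have hfl : ⌊t⌋₊ = n := by
          rw [Nat.floor_eq_iff ((Nat.cast_nonneg n).trans ht.1)]
          exact ⟨ht.1, by exact_mod_cast h2⟩
        have hfr : Int.fract t = t - n := by
          rw [Int.fract_eq_iff]
          push_cast at h2
          exact ⟨by linarith [ht.1], by linarith, n, by push_cast; ring⟩
        simp only [Th, hfl, hfr]
    have hu : Icc (0:ℝ) ((n+1:ℕ):ℝ) = Icc 0 (n:ℝ) ∪ Icc (n:ℝ) ((n+1:ℕ):ℝ) :=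
      (Icc_union_Icc_eq_Icc (Nat.cast_nonneg n) (by push_cast; linarith)).symm
    rw [hu]
    exact ih.union_of_isClosed h isClosed_Icc isClosed_Icc

lemma Th_lift (p : Pl) (θ : ℝ) (t : ℝ) : ∃ r : ℝ, 0 < r ∧ S.D t p (uu θ) = r • uu (S.Th p θ t) := by
  obtain ⟨r, hr, e⟩ := S.An_lift ⌊t⌋₊ p θ
  obtain ⟨r', hr', e'⟩ := S.Phi_lift (t := Int.fract t) ⟨Int.fract_nonneg t, (Int.fract_lt_one t).le⟩
    (S.F^[⌊t⌋₊] p) (S.An ⌊t⌋₊ p θ)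
  refine ⟨r * r', by positivity, ?_⟩
  simp only [D, ContinuousLinearMap.comp_apply, e, map_smul, e', smul_smul, Th]

lemma angleVar_An (p : Pl) {s : ℝ} (hs : 0 < s) (θ : ℝ) (n : ℕ) :
    S.AngleVar p (s • uu θ) n (S.An n p θ - θ) := by
  refine ⟨S.Th p θ, S.Th_cont p θ n, ?_, ?_⟩
  · intro t _
    obtain ⟨r, hr, e⟩ := S.Th_lift p θ t
    refine ⟨s * r, by positivity, ?_⟩
    rw [map_smul, e, smul_smul]; rfl
  · rw [Th_nat]
    have := S.Th_nat p θ 0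
    simp only [Nat.cast_zero] at this
    rw [this]; rfl

lemma angleVar_unique (p : Pl) (n : ℕ) {a : ℝ} (h : S.AngleVar p vv n a) : a = S.An n p 0 := by
  obtain ⟨Θ, hc, hl, rfl⟩ := h
  have := angle_unique (s := Icc (0:ℝ) n) isPreconnected_Icc hc (S.Th_cont p 0 n)
    (V := fun t => S.D t p vv) hl (fun t _ => by rw [← uu_zero]; exact S.Th_lift p 0 t)
    (x := n) (y := 0) (by simp) (by simp)
  rw [this, Th_nat]
  have := S.Th_nat p 0 0
  simp only [Nat.cast_zero] at this
  rw [this]; simp [An]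

lemma twist_fderiv (ht : S.PosTwist) (p : Pl) : 0 < (fderiv ℝ S.F p (0, 1)).1 := by
  have h := (ht p.1).2.2 p.2
  have h1 : HasDerivAt (fun y : ℝ => ((p.1, y) : Pl)) ((0:ℝ), (1:ℝ)) p.2 :=
    (hasDerivAt_const p.2 p.1).prodMk (hasDerivAt_id p.2)
  have h2 : HasFDerivAt S.F (fderiv ℝ S.F p) (p.1, p.2) := (S.F_diff p).hasFDerivAt
  have h3 := h2.comp_hasDerivAt p.2 h1
  have h4 : HasDerivAt (fun y => (S.F (p.1, y)).1) (fderiv ℝ S.F p (0,1)).1 p.2 := by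
    have := (ContinuousLinearMap.fst ℝ ℝ ℝ).hasFDerivAt.comp_hasDerivAt p.2 h3
    exact this
  rw [h4.deriv] at h
  exact h

/-- the one-step angle of the vertical stays in a fixed open half-unit interval -/
lemma twist_range (ht : S.PosTwist) :
    ∃ m : ℤ, ∀ p, (m:ℝ)/2 < S.phi p 0 ∧ S.phi p 0 < (m:ℝ)/2 + 1/2 := by
  have hne : ∀ p (m : ℤ), S.phi p 0 ≠ (m:ℝ)/2 := by
    intro p m hm
    obtain ⟨r, hr, e⟩ := S.phi_lift p 0
    have h := S.twist_fderiv ht p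
    have h0 : uu 0 = (0, 1) := uu_zero
    rw [h0, hm] at e
    rw [e] at h
    simp only [uu, Prod.smul_fst, smul_eq_mul] at h
    have : 2 * Real.pi * ((m:ℝ)/2) = m * Real.pi := by ring
    rw [this, Real.sin_int_mul_pi] at h
    simp at h
  have hc : Continuous (fun p => S.phi p 0) := S.phi_cont.comp (f := fun p : Pl => (p, (0:ℝ))) (by fun_prop)
  set m : ℤ := ⌊2 * S.phi 0 0⌋ with hm
  have h0 : (m:ℝ)/2 < S.phi 0 0 ∧ S.phi 0 0 < (m:ℝ)/2 + 1/2 := by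
    have h1 := Int.floor_le (2 * S.phi 0 0)
    have h2 := Int.lt_floor_add_one (2 * S.phi 0 0)
    rw [← hm] at h1 h2
    exact ⟨lt_of_le_of_ne (by linarith) (hne 0 m).symm, by linarith⟩
  refine ⟨m, fun p => ⟨?_, ?_⟩⟩
  · by_contra hcon
    obtain ⟨q, hq⟩ := mem_range_of_exists_le_of_exists_ge hc ⟨p, not_lt.mp hcon⟩ ⟨0, h0.1.le⟩
    exact hne q m hq
  · by_contra hcon
    obtain ⟨q, hq⟩ := mem_range_of_exists_le_of_exists_ge hc ⟨0, h0.2.le⟩ ⟨p, not_lt.mp hcon⟩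
    apply hne q (m+1)
    have hq' : S.phi q 0 = (m:ℝ)/2 + 1/2 := hq
    rw [hq']; push_cast; ring

end IsotopySetup

section Birk
set_option linter.unusedSectionVars false
variable {α : Type*} [MeasurableSpace α]

def maxSum (T : α → α) (g : α → ℝ) : ℕ → α → ℝ
  | 0 => fun _ => 0
  | n + 1 => fun x => max 0 (g x + maxSum T g n (T x))

lemma maxSum_measurable {T : α → α} {g : α → ℝ} (hT : Measurable T) (hg : Measurable g) (n : ℕ) :
    Measurable (maxSum T g n) := by
  induction n with
  | zero => exact measurable_const
  | succ n ih => exact measurable_const.max (hg.add (ih.comp hT))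

lemma maxSum_nonneg (T : α → α) (g : α → ℝ) (n : ℕ) (x : α) : 0 ≤ maxSum T g n x := by
  cases n with
  | zero => exact le_rfl
  | succ n => exact le_max_left _ _

lemma maxSum_le_succ (T : α → α) (g : α → ℝ) (n : ℕ) :
    ∀ x, maxSum T g n x ≤ maxSum T g (n+1) x := by
  induction n with
  | zero => intro x; exact le_max_left _ _
  | succ n ih =>
    intro x
    exact max_le_max le_rfl (add_le_add le_rfl (ih (T x)))

lemma maxSum_mono (T : α → α) (g : α → ℝ) (x : α) : Monotone (fun n => maxSum T g n x) :=
  monotone_nat_of_le_succ (fun n => maxSum_le_succ T g n x)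

lemma maxSum_le {T : α → α} {g : α → ℝ} {C : ℝ} (hC : ∀ x, |g x| ≤ C) (n : ℕ) :
    ∀ x, maxSum T g n x ≤ n * C := by
  induction n with
  | zero => intro x; simp [maxSum]
  | succ n ih =>
    intro x
    have h0 : 0 ≤ C := (abs_nonneg _).trans (hC x)
    refine max_le (by positivity) ?_
    have := ih (T x)
    have := (abs_le.mp (hC x)).2
    push_cast; linarith

lemma sum_le_maxSum (T : α → α) (g : α → ℝ) (n : ℕ) :
    ∀ x, birkhoffSum T g n x ≤ maxSum T g n x := by
  induction n with
  | zero => intro x; simp [maxSum]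
  | succ n ih =>
    intro x
    rw [birkhoffSum_succ']
    exact le_max_of_le_right (add_le_add le_rfl (ih (T x)))

lemma max_ergodic {μ : Measure α} [IsFiniteMeasure μ] {T : α → α} (hT : MeasurePreserving T μ μ)
    {g : α → ℝ} (hg : Measurable g) {C : ℝ} (hC : ∀ x, |g x| ≤ C)
    (hpos : ∀ᵐ x ∂μ, ∃ n, 0 < birkhoffSum T g n x) : 0 ≤ ∫ x, g x ∂μ := by
  have hMi : ∀ n, Integrable (maxSum T g n) μ := fun n =>
    Integrable.of_bound (maxSum_measurable hT.measurable hg n).aestronglyMeasurable (n * C)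
      (ae_of_all _ fun x => by
        rw [Real.norm_eq_abs, abs_of_nonneg (maxSum_nonneg _ _ _ _)]
        exact maxSum_le hC n x)
  have hgi : Integrable g μ := Integrable.of_bound hg.aestronglyMeasurable C
    (ae_of_all _ fun x => hC x)
  have hms : ∀ n, MeasurableSet {x | 0 < maxSum T g n x} := fun n =>
    measurableSet_lt measurable_const (maxSum_measurable hT.measurable hg n)
  have key : ∀ n, 0 ≤ ∫ x, ({x | 0 < maxSum T g n x}.indicator g) x ∂μ := by
    intro n
    have h1 : ∫ x, maxSum T g n (T x) ∂μ = ∫ x, maxSum T g n x ∂μ := by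
      have := integral_map (μ := μ) hT.measurable.aemeasurable (f := maxSum T g n)
        (maxSum_measurable hT.measurable hg n).aestronglyMeasurable
      rw [hT.map_eq] at this
      exact this.symm
    have h2 : Integrable (fun x => maxSum T g n (T x)) μ := hT.integrable_comp_of_integrable (hMi n)
    have h3 : ∫ x, (maxSum T g n x - maxSum T g n (T x)) ∂μ = 0 := by
      rw [integral_sub (hMi n) h2, h1, sub_self]
    refine h3.symm.le.trans ?_
    apply integral_mono ((hMi n).sub h2) (hgi.indicator (hms n))
    intro x
    show maxSum T g n x - maxSum T g n (T x) ≤ ({x | 0 < maxSum T g n x}.indicator g) x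
    by_cases hx : 0 < maxSum T g n x
    · simp only [indicator, mem_ofPred_eq, hx, if_true]
      cases n with
      | zero => simp [maxSum] at hx
      | succ n =>
        have e : maxSum T g (n+1) x = max 0 (g x + maxSum T g n (T x)) := rfl
        have e2 : maxSum T g (n+1) x = g x + maxSum T g n (T x) := by
          rw [e] at hx ⊢
          exact max_eq_right (by
            by_contra hcon
            rw [max_eq_left (by linarith)] at hx
            exact lt_irrefl _ hx)
        have := maxSum_le_succ T g n (T x)
        linarith
    · simp only [indicator, mem_ofPred_eq, hx, if_false]
      have := maxSum_nonneg T g n (T x)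
      linarith
  have lim : Tendsto (fun n => ∫ x, ({x | 0 < maxSum T g n x}.indicator g) x ∂μ) atTop
      (𝓝 (∫ x, g x ∂μ)) := by
    apply tendsto_integral_of_dominated_convergence (fun _ => C)
    · intro n; exact (hg.indicator (hms n)).aestronglyMeasurable
    · exact integrable_const C
    · intro n
      refine ae_of_all _ fun x => ?_
      exact (norm_indicator_le_norm_self _ _).trans (hC x)
    · filter_upwards [hpos] with x hx
      obtain ⟨N, hN⟩ := hx
      apply tendsto_const_nhds.congr'
      filter_upwards [eventually_ge_atTop N] with n hn
      have : 0 < maxSum T g n x := lt_of_lt_of_le (hN.trans_le (sum_le_maxSum T g N x))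
        (maxSum_mono T g x hn)
      simp [indicator, this]
  exact ge_of_tendsto' lim key

def lowSet (T : α → α) (g : α → ℝ) (a : ℝ) : Set α :=
  {x | ∃ q : ℚ, (q : ℝ) < a ∧ ∃ᶠ n in atTop, birkhoffAverage ℝ T g n x < q}

lemma birk_meas {T : α → α} {g : α → ℝ} (hT : Measurable T) (hg : Measurable g) (n : ℕ) :
    Measurable (birkhoffAverage ℝ T g n) := by
  have : birkhoffAverage ℝ T g n = fun x => (n:ℝ)⁻¹ • ∑ k ∈ Finset.range n, g (T^[k] x) := rfl
  rw [this]
  have h : Measurable (fun x => ∑ k ∈ Finset.range n, g (T^[k] x)) :=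
    Finset.measurable_sum _ (fun k _ => hg.comp (hT.iterate k))
  exact h.const_smul (n:ℝ)⁻¹

lemma lowSet_meas {T : α → α} {g : α → ℝ} (hT : Measurable T) (hg : Measurable g) (a : ℝ) :
    MeasurableSet (lowSet T g a) := by
  have : lowSet T g a = ⋃ q : ℚ, ⋃ _ : (q:ℝ) < a, ⋂ N : ℕ, ⋃ n : ℕ, ⋃ _ : N ≤ n,
      {x | birkhoffAverage ℝ T g n x < q} := by
    ext x; simp [lowSet, frequently_atTop]
  rw [this]
  refine MeasurableSet.iUnion fun q => MeasurableSet.iUnion fun _ => MeasurableSet.iInter fun N =>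
    MeasurableSet.iUnion fun n => MeasurableSet.iUnion fun _ => ?_
  exact measurableSet_lt (birk_meas hT hg n) measurable_const

lemma freq_transfer {u v : ℕ → ℝ} (h : Tendsto (fun n => u n - v n) atTop (𝓝 0)) {a : ℝ}
    (hu : ∃ q : ℚ, (q : ℝ) < a ∧ ∃ᶠ n in atTop, u n < q) :
    ∃ q : ℚ, (q : ℝ) < a ∧ ∃ᶠ n in atTop, v n < q := by
  obtain ⟨q, hq, hf⟩ := hu
  obtain ⟨q', h1, h2⟩ := exists_rat_btwn hq
  refine ⟨q', h2, ?_⟩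
  have ev : ∀ᶠ n in atTop, (q:ℝ) - q' < u n - v n := h.eventually_const_lt (by linarith)
  refine (hf.and_eventually ev).mono ?_
  rintro n ⟨h3, h4⟩
  linarith

lemma lowSet_inv {T : α → α} {g : α → ℝ} {C : ℝ} (hC : ∀ x, |g x| ≤ C) (a : ℝ) :
    T ⁻¹' lowSet T g a = lowSet T g a := by
  have hb : Bornology.IsBounded (range g) := by
    rw [isBounded_iff_forall_norm_le]
    exact ⟨C, by rintro _ ⟨x, rfl⟩; exact hC x⟩
  have h := fun x => tendsto_birkhoffAverage_apply_sub_birkhoffAverage' ℝ hb T x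
  ext x
  constructor
  · intro hx
    exact freq_transfer (h x) hx
  · intro hx
    refine freq_transfer ?_ hx
    have := (h x).neg
    simpa using this

lemma lowSet_int {μ : Measure α} [IsFiniteMeasure μ] {T : α → α} (hT : MeasurePreserving T μ μ)
    {g : α → ℝ} (hg : Measurable g) {C : ℝ} (hC : ∀ x, |g x| ≤ C) (a : ℝ) {E : Set α}
    (hE : MeasurableSet E) (hEi : T ⁻¹' E = E) (hEs : E ⊆ lowSet T g a) :
    ∫ x in E, g x ∂μ ≤ a * μ.real E := by
  have hTE : MeasurePreserving T (μ.restrict E) (μ.restrict E) := by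
    have := hT.restrict_preimage hE
    rwa [hEi] at this
  have hgi : Integrable g (μ.restrict E) := Integrable.of_bound hg.aestronglyMeasurable C
    (ae_of_all _ fun x => hC x)
  have := max_ergodic hTE (g := fun x => a - g x) (measurable_const.sub hg) (C := |a| + C)
    (fun x => (abs_sub _ _).trans (add_le_add le_rfl (hC x))) (by
      refine (ae_restrict_iff' hE).mpr (ae_of_all _ fun x hx => ?_)
      obtain ⟨q, hq, hf⟩ := hEs hx
      obtain ⟨n, h1, h2⟩ := (hf.and_eventually (eventually_ge_atTop 1)).exists
      refine ⟨n, ?_⟩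
      have hn : (0:ℝ) < n := by exact_mod_cast h2
      have e : birkhoffSum T (fun x => a - g x) n x = n * a - birkhoffSum T g n x := by
        simp [birkhoffSum, Finset.sum_sub_distrib]
      rw [e]
      have h3 : (n:ℝ)⁻¹ * birkhoffSum T g n x < a := lt_trans h1 hq
      have : birkhoffSum T g n x = n * ((n:ℝ)⁻¹ * birkhoffSum T g n x) := by field_simp
      rw [this]
      nlinarith)
  rw [integral_sub (integrable_const _) hgi] at this
  simp at this
  linarith

theorem birkhoff_ae {μ : Measure α} [IsFiniteMeasure μ] {T : α → α} (hT : MeasurePreserving T μ μ)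
    {g : α → ℝ} (hg : Measurable g) {C : ℝ} (hC : ∀ x, |g x| ≤ C) :
    ∀ᵐ x ∂μ, ∃ l, Tendsto (fun n => birkhoffAverage ℝ T g n x) atTop (𝓝 l) := by
  have hC' : ∀ x, |(-g) x| ≤ C := fun x => by simpa using hC x
  have hE : ∀ a b : ℚ, a < b → ∀ᵐ x ∂μ, x ∉ lowSet T g a ∩ lowSet T (-g) (-b) := by
    intro a b hab
    set E := lowSet T g a ∩ lowSet T (-g) (-b) with hEdef
    have hm : MeasurableSet E := (lowSet_meas hT.measurable hg _).inter
      (lowSet_meas hT.measurable hg.neg _)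
    have hi : T ⁻¹' E = E := by rw [hEdef, preimage_inter, lowSet_inv hC, lowSet_inv hC']
    have h1 := lowSet_int hT hg hC a hm hi inter_subset_left
    have h2 := lowSet_int hT hg.neg hC' (-b) hm hi inter_subset_right
    simp only [Pi.neg_apply] at h2
    rw [integral_neg] at h2
    have hab' : (a:ℝ) < b := by exact_mod_cast hab
    have h0 : μ.real E = 0 := by
      have := measureReal_nonneg (μ := μ) (s := E)
      nlinarith
    rw [measureReal_eq_zero_iff] at h0
    exact measure_eq_zero_iff_ae_notMem.mp h0
  have hall : ∀ᵐ x ∂μ, ∀ a b : ℚ, a < b → x ∉ lowSet T g a ∩ lowSet T (-g) (-b) := by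
    simp only [ae_all_iff]
    exact hE
  filter_upwards [hall] with x hx
  have hbd : ∀ n, |birkhoffAverage ℝ T g n x| ≤ C := by
    intro n
    have hC0 : 0 ≤ C := (abs_nonneg _).trans (hC x)
    have : |birkhoffSum T g n x| ≤ n * C := by
      refine (Finset.abs_sum_le_sum_abs _ _).trans ?_
      refine (Finset.sum_le_card_nsmul _ _ C (fun k _ => hC _)).trans ?_
      simp
    rw [birkhoffAverage, smul_eq_mul, abs_mul, abs_inv, Nat.abs_cast]
    rcases Nat.eq_zero_or_pos n with rfl | hn
    · simpa using hC0
    · rw [inv_mul_le_iff₀ (by exact_mod_cast hn)]; exact this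
  refine tendsto_of_no_upcrossings (s := range ((↑) : ℚ → ℝ)) Rat.denseRange_cast ?_ ?_ ?_
  · rintro _ ⟨a, rfl⟩ _ ⟨b, rfl⟩ hab ⟨h1, h2⟩
    have hab : a < b := by exact_mod_cast hab
    obtain ⟨a', ha, hb⟩ := exists_between hab
    obtain ⟨b', ha', hb'⟩ := exists_between hb
    refine hx a' b' ha' ⟨⟨a, by exact_mod_cast ha, h1⟩, ⟨-b, ?_, ?_⟩⟩
    · push_cast; simpa using hb'
    · refine h2.mono fun n hn => ?_
      rw [birkhoffAverage_neg]
      simpa using hn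
  · exact isBoundedUnder_of ⟨C, fun n => (abs_le.mp (hbd n)).2⟩
  · exact isBoundedUnder_of ⟨-C, fun n => (abs_le.mp (hbd n)).1⟩

/-- Points of a set return to it with positive frequency almost surely. -/
theorem birkhoff_return {μ : Measure α} [IsFiniteMeasure μ] {T : α → α}
    (hT : MeasurePreserving T μ μ) {W : Set α} (hW : MeasurableSet W) :
    ∀ᵐ x ∂μ, x ∈ W → ∃ l, 0 < l ∧
      Tendsto (fun n => birkhoffAverage ℝ T (W.indicator (fun _ => (1:ℝ))) n x) atTop (𝓝 l) := by
  set g : α → ℝ := W.indicator (fun _ => (1:ℝ)) with hgdef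
  have hg : Measurable g := measurable_const.indicator hW
  have hg0 : ∀ x, 0 ≤ g x := fun x => indicator_nonneg (fun _ _ => zero_le_one) x
  have hg1 : ∀ x, g x ≤ 1 := fun x => indicator_le_self' (fun _ _ => zero_le_one) x
  have hC : ∀ x, |g x| ≤ 1 := fun x => abs_le.mpr ⟨by linarith [hg0 x], hg1 x⟩
  let h : α → ℝ := fun x => 1 - g x
  -- the set on which the averages have small values for every threshold
  have hav0 : ∀ n x, 0 ≤ birkhoffAverage ℝ T g n x := fun n x => by
    rw [birkhoffAverage, smul_eq_mul]
    exact mul_nonneg (by positivity) (Finset.sum_nonneg fun k _ => hg0 _)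
  have hE : ∀ᵐ x ∂μ, x ∉ W ∩ ⋂ k : ℕ, lowSet T g (1 / ((k:ℝ) + 1)) := by
    set E := ⋂ k : ℕ, lowSet T g (1 / ((k:ℝ) + 1)) with hEdef
    have hm : MeasurableSet E := MeasurableSet.iInter fun k => lowSet_meas hT.measurable hg _
    have hi : T ⁻¹' E = E := by
      rw [hEdef, preimage_iInter]
      exact iInter_congr fun k => lowSet_inv hC _
    have h1 : ∀ k : ℕ, ∫ x in E, g x ∂μ ≤ 1 / ((k:ℝ) + 1) * μ.real E := fun k =>
      lowSet_int hT hg hC _ hm hi (iInter_subset _ k)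
    have h2 : ∫ x in E, g x ∂μ ≤ 0 := by
      have : Tendsto (fun k : ℕ => 1 / ((k:ℝ) + 1) * μ.real E) atTop (𝓝 (0 * μ.real E)) :=
        tendsto_one_div_add_atTop_nhds_zero_nat.mul_const _
      rw [zero_mul] at this
      exact ge_of_tendsto' this h1
    have h3 : ∫ x in E, g x ∂μ = μ.real (W ∩ E) := by
      rw [hgdef, integral_indicator_const _ hW]
      simp [measureReal_restrict_apply hW]
    have h0 : μ.real (W ∩ E) = 0 := le_antisymm (h3 ▸ h2) measureReal_nonneg
    rw [measureReal_eq_zero_iff] at h0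
    exact measure_eq_zero_iff_ae_notMem.mp h0
  filter_upwards [hE, birkhoff_ae hT hg hC] with x hx ⟨l, hl⟩ hxW
  refine ⟨l, ?_, hl⟩
  by_contra hl0
  apply hx
  refine ⟨hxW, mem_iInter.mpr fun k => ?_⟩
  have hk : (0:ℝ) < 1 / ((k:ℝ) + 1) := by positivity
  obtain ⟨q, hq0, hq⟩ := exists_rat_btwn hk
  exact ⟨q, hq, (hl.eventually_lt_const (by linarith)).frequently⟩

end Birk

lemma sum_shift (c : ℕ → ℝ) (n N : ℕ) :
    ∑ j ∈ Finset.range n, (c (j + N) - c j) = ∑ i ∈ Finset.range N, (c (n + i) - c i) := by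
  have h1 := Finset.sum_range_add c n N
  have h2 := Finset.sum_range_add c N n
  rw [add_comm N n] at h2
  have h3 : ∑ j ∈ Finset.range n, c (j + N) = ∑ j ∈ Finset.range n, c (N + j) :=
    Finset.sum_congr rfl fun j _ => by rw [add_comm]
  rw [Finset.sum_sub_distrib, Finset.sum_sub_distrib, h3]
  linarith

section Det
variable {α : Type*} {T : α → α} {a : ℕ → α → ℝ} {C : ℝ}

lemma quasi_bound (hQ : ∀ n m x, |a (n + m) x - a n x - a m (T^[n] x)| ≤ 1)
    (hB : ∀ x, |a 1 x| ≤ C) (h0 : ∀ x, a 0 x = 0) (n : ℕ) (x : α) : |a n x| ≤ n * (C + 1) := by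
  induction n with
  | zero => simp [h0]
  | succ n ih =>
    have h1 := abs_le.mp (hQ n 1 x)
    have h2 := abs_le.mp (hB (T^[n] x))
    have h3 := abs_le.mp ih
    rw [abs_le]; push_cast
    constructor <;> linarith [h1.1, h1.2, h2.1, h2.2, h3.1, h3.2]

lemma quasi_avg (hQ : ∀ n m x, |a (n + m) x - a n x - a m (T^[n] x)| ≤ 1)
    (hB : ∀ x, |a 1 x| ≤ C) (h0 : ∀ x, a 0 x = 0) (n N : ℕ) (x : α) :
    |birkhoffSum T (a N) n x - N * a n x| ≤ n + N * (2 * N * (C + 1) + 1) := by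
  have hC : 0 ≤ C := (abs_nonneg _).trans (hB x)
  have h1 : |birkhoffSum T (a N) n x - ∑ j ∈ Finset.range n, (a (j + N) x - a j x)| ≤ n := by
    rw [birkhoffSum, ← Finset.sum_sub_distrib]
    refine (Finset.abs_sum_le_sum_abs _ _).trans ?_
    refine (Finset.sum_le_card_nsmul _ _ 1 (fun k _ => ?_)).trans (by simp)
    rw [abs_sub_comm]; exact hQ k N x
  have h2 : |∑ i ∈ Finset.range N, (a (n + i) x - a i x) - N * a n x|
      ≤ N * (2 * N * (C + 1) + 1) := by
    have : (N:ℝ) * a n x = ∑ i ∈ Finset.range N, a n x := by simp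
    rw [this, ← Finset.sum_sub_distrib]
    refine (Finset.abs_sum_le_sum_abs _ _).trans ?_
    refine (Finset.sum_le_card_nsmul _ _ (2 * N * (C + 1) + 1) (fun i hi => ?_)).trans
      (by rw [Finset.card_range, nsmul_eq_mul])
    have hi' : (i:ℝ) ≤ N := by exact_mod_cast (Finset.mem_range.mp hi).le
    have e1 := abs_le.mp (hQ n i x)
    have e2 := abs_le.mp (quasi_bound hQ hB h0 i x)
    have e3 := abs_le.mp (quasi_bound hQ hB h0 i (T^[n] x))
    have e4 : (i:ℝ) * (C + 1) ≤ N * (C + 1) := by gcongr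
    rw [abs_le]
    constructor <;> linarith [e1.1, e1.2, e2.1, e2.2, e3.1, e3.2]
  rw [sum_shift (fun j => a j x)] at h1
  rw [abs_le] at *
  constructor <;> linarith [h1.1, h1.2, h2.1, h2.2]

lemma quasi_conv (hQ : ∀ n m x, |a (n + m) x - a n x - a m (T^[n] x)| ≤ 1)
    (hB : ∀ x, |a 1 x| ≤ C) (h0 : ∀ x, a 0 x = 0) (x : α)
    (hconv : ∀ N : ℕ, ∃ l, Tendsto (fun n => birkhoffAverage ℝ T (a N) n x) atTop (𝓝 l)) :
    ∃ L, Tendsto (fun n : ℕ => a n x / (n:ℝ)) atTop (𝓝 L) := by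
  apply cauchySeq_tendsto_of_complete
  rw [Metric.cauchySeq_iff']
  intro ε hε
  obtain ⟨N, hN⟩ := exists_nat_gt (8 / ε)
  have hN0 : (0:ℝ) < N := lt_trans (by positivity) hN
  obtain ⟨l, hl⟩ := hconv N
  have hK : Tendsto (fun n : ℕ => (N * (2 * N * (C + 1) + 1)) / (n:ℝ)) atTop (𝓝 0) :=
    tendsto_const_div_atTop_nhds_zero_nat _
  have ev1 := hl.eventually (Metric.ball_mem_nhds l (show 0 < N * (ε / 8) by positivity))
  have ev2 := hK.eventually_lt_const (show 0 < N * (ε / 8) by positivity)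
  obtain ⟨M, hM⟩ := ((ev1.and ev2).and (eventually_ge_atTop 1)).exists_forall_of_atTop
  have key : ∀ n ≥ M, |a n x / n - l / N| < ε / 2 := by
    intro n hn
    obtain ⟨⟨h1, h2⟩, h3⟩ := hM n hn
    have hn0 : (0:ℝ) < n := by exact_mod_cast h3
    rw [Real.dist_eq] at h1
    have h4 := quasi_avg hQ hB h0 n N x
    have h5 : |birkhoffAverage ℝ T (a N) n x - N * (a n x / n)|
        ≤ 1 + (N * (2 * N * (C + 1) + 1)) / (n:ℝ) := by
      have e : birkhoffAverage ℝ T (a N) n x - N * (a n x / n)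
          = (birkhoffSum T (a N) n x - N * a n x) / n := by
        rw [birkhoffAverage, smul_eq_mul]; field_simp
      rw [e, abs_div, abs_of_pos hn0, div_le_iff₀ hn0]
      refine h4.trans (le_of_eq ?_)
      field_simp
    have h6 : 8 < N * ε := by rwa [div_lt_iff₀ hε] at hN
    have h7 : |N * (a n x / n - l / N)| < N * (ε / 2) := by
      have e : N * (a n x / n - l / N) = N * (a n x / n) - l := by field_simp
      rw [e]
      rw [abs_lt] at *
      rw [abs_le] at h5
      constructor <;> linarith [h5.1, h5.2, h1.1, h1.2]
    rw [abs_mul, abs_of_pos hN0] at h7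
    exact lt_of_mul_lt_mul_left h7 hN0.le
  refine ⟨M, fun n hn => ?_⟩
  rw [Real.dist_eq]
  have k1 := abs_lt.mp (key n hn)
  have k2 := abs_lt.mp (key M le_rfl)
  rw [abs_lt]
  constructor <;> linarith [k1.1, k1.2, k2.1, k2.2]

lemma subadd_neg {b : ℕ → α → ℝ} (hS : ∀ n m x, b (n + m) x ≤ b n x + b m (T^[n] x))
    (h0 : ∀ x, b 0 x = 0) (h1 : ∀ x, b 1 x ≤ 0) {W : Set α} {N : ℕ}
    (hW : ∀ x ∈ W, b N x ≤ -1) (n : ℕ) (x : α) :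
    N * b (n + N) x ≤ - birkhoffSum T (W.indicator (fun _ => (1:ℝ))) n x := by
  have hanti : ∀ x, Antitone (fun n => b n x) := fun x => antitone_nat_of_succ_le fun n => by
    have := hS n 1 x
    have := h1 (T^[n] x)
    linarith
  have hneg : ∀ n x, b n x ≤ 0 := fun n x => (h0 x) ▸ hanti x (Nat.zero_le n)
  have e1 : ∑ j ∈ Finset.range n, (b (j + N) x - b j x)
      ≤ - birkhoffSum T (W.indicator (fun _ => (1:ℝ))) n x := by
    rw [birkhoffSum, ← Finset.sum_neg_distrib]
    refine Finset.sum_le_sum fun j _ => ?_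
    have h2 := hS j N x
    by_cases hx : T^[j] x ∈ W
    · rw [indicator_of_mem hx]
      have := hW _ hx
      linarith
    · rw [indicator_of_notMem hx]
      have := hneg N (T^[j] x)
      linarith
  rw [sum_shift (fun j => b j x)] at e1
  refine le_trans ?_ e1
  have : (N:ℝ) * b (n + N) x = ∑ i ∈ Finset.range N, b (n + N) x := by simp
  rw [this]
  refine Finset.sum_le_sum fun i hi => ?_
  have h2 : b (n + N) x ≤ b (n + i) x := hanti x (by
    have := Finset.mem_range.mp hi; omega)
  have := hneg i x
  linarith

end Det

lemma pr_open : IsOpenQuotientMap pr := by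
  have h1 : IsOpenQuotientMap ((↑) : ℝ → AddCircle (1:ℝ)) := QuotientAddGroup.isOpenQuotientMap_mk
  exact h1.prodMap IsOpenQuotientMap.id

lemma pr_eq {p q : Pl} (h : pr p = pr q) : ∃ m : ℤ, p = q + ((m:ℝ), 0) := by
  have h1 : (p.1 : AddCircle (1:ℝ)) = q.1 := congrArg Prod.fst h
  have h2 : p.2 = q.2 := congrArg (fun z : Ann => z.2) h
  have h3 : ((p.1 - q.1 : ℝ) : AddCircle (1:ℝ)) = 0 := by rw [AddCircle.coe_sub, h1, sub_self]
  rw [AddCircle.coe_eq_zero_iff] at h3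
  obtain ⟨m, hm⟩ := h3
  refine ⟨m, Prod.ext ?_ ?_⟩
  · simp at hm ⊢; linarith
  · simp [h2]

namespace IsotopySetup
variable (S : IsotopySetup)

lemma An_pr (n : ℕ) {p q : Pl} (h : pr p = pr q) (θ : ℝ) : S.An n p θ = S.An n q θ := by
  have hnat : ∀ (k : ℕ) (q : Pl), S.An n (q + ((k:ℝ), 0)) θ = S.An n q θ := by
    intro k
    induction k with
    | zero => intro q; congr 1; ext <;> simp
    | succ k ih =>
      intro q
      have e : q + (((k+1:ℕ):ℝ), (0:ℝ)) = (q + ((k:ℝ), 0)) + (1, 0) := by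
        ext <;> simp [add_assoc]
      rw [e, S.An_periodic, ih]
  obtain ⟨m, rfl⟩ := pr_eq h
  obtain ⟨k, rfl | rfl⟩ := m.eq_nat_or_neg
  · rw [Int.cast_natCast]; exact hnat k q
  · rw [← hnat k]
    congr 1
    ext <;> simp

/-- angle function on the annulus -/
def an (n : ℕ) (z : Ann) : ℝ := S.An n (surjInv pr_open.surjective z) 0

lemma an_pr (n : ℕ) (p : Pl) : S.an n (pr p) = S.An n p 0 :=
  S.An_pr n (surjInv_eq pr_open.surjective _) 0

lemma an_cont (n : ℕ) : Continuous (S.an n) := by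
  have : Continuous (S.an n ∘ pr) := by
    have e : S.an n ∘ pr = fun p => S.An n p 0 := funext (S.an_pr n)
    rw [e]
    exact (S.An_cont n).comp (f := fun p : Pl => (p, (0:ℝ))) (by fun_prop)
  exact pr_open.isQuotientMap.continuous_iff.mpr this

lemma f_pr (p : Pl) : S.f (pr p) = pr (S.F p) := (S.lift_f p).symm

lemma fn_pr (n : ℕ) (p : Pl) : S.f^[n] (pr p) = pr (S.F^[n] p) := by
  induction n with
  | zero => rfl
  | succ n ih => rw [iterate_succ_apply', iterate_succ_apply', ih, f_pr]

lemma f_open : IsOpenMap S.f := by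
  intro V hV
  have hFo : IsOpenMap S.F := by
    obtain ⟨G, hG, hl, hr⟩ := S.Ft_diffeo 1 (by simp)
    exact IsOpenMap.of_inverse hG.continuous hr hl
  have : S.f '' V = pr '' (S.F '' (pr ⁻¹' V)) := by
    ext z
    constructor
    · rintro ⟨y, hy, rfl⟩
      obtain ⟨p, rfl⟩ := pr_open.surjective y
      exact ⟨S.F p, ⟨p, hy, rfl⟩, (S.f_pr p).symm⟩
    · rintro ⟨_, ⟨p, hp, rfl⟩, rfl⟩
      exact ⟨pr p, hp, S.f_pr p⟩
  rw [this]
  exact pr_open.isOpenMap _ (hFo _ (hV.preimage pr_open.continuous))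

lemma An_quasi (n : ℕ) (p : Pl) (θ : ℝ) : |S.An n p θ - S.An n p 0 - θ| ≤ 1/2 := by
  have h1 := Int.floor_le (2 * θ)
  have h2 := Int.lt_floor_add_one (2 * θ)
  have e1 := half_int (S.An_half n p) ⌊2 * θ⌋ 0
  have e2 := half_int (S.An_half n p) (⌊2 * θ⌋ + 1) 0
  rw [zero_add] at e1 e2
  have m1 := (S.An_strictMono n p).monotone (show (⌊2 * θ⌋:ℝ)/2 ≤ θ by linarith)
  have m2 := (S.An_strictMono n p).monotone
    (show θ ≤ ((⌊2 * θ⌋ + 1 : ℤ):ℝ)/2 by push_cast; linarith)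
  rw [e1] at m1
  rw [e2] at m2
  push_cast at m2
  rw [abs_le]; constructor <;> linarith

lemma an_add (n m : ℕ) (p : Pl) :
    S.an (n + m) (pr p) = S.An m (S.F^[n] p) (S.an n (pr p)) := by
  rw [an_pr, an_pr, An_add]

lemma an_quasi (n m : ℕ) (z : Ann) : |S.an (n + m) z - S.an n z - S.an m (S.f^[n] z)| ≤ 1 := by
  obtain ⟨p, rfl⟩ := pr_open.surjective z
  rw [an_add, fn_pr, S.an_pr m]
  have := abs_le.mp (S.An_quasi m (S.F^[n] p) (S.an n (pr p)))
  rw [abs_le]; constructor <;> linarith [this.1, this.2]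

lemma an_ceil (n m : ℕ) (z : Ann) :
    ((⌈2 * S.an (n + m) z⌉ : ℤ) : ℝ) ≤ (⌈2 * S.an n z⌉ : ℤ) + (⌈2 * S.an m (S.f^[n] z)⌉ : ℤ) := by
  obtain ⟨p, rfl⟩ := pr_open.surjective z
  have h1 : S.an n (pr p) ≤ ((⌈2 * S.an n (pr p)⌉ : ℤ):ℝ)/2 := by
    have := Int.le_ceil (2 * S.an n (pr p)); linarith
  have h2 := (S.An_strictMono m (S.F^[n] p)).monotone h1
  have e := half_int (S.An_half m (S.F^[n] p)) ⌈2 * S.an n (pr p)⌉ 0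
  rw [zero_add] at e
  rw [e, ← an_add, ← an_pr, ← fn_pr] at h2
  have h3 := Int.le_ceil (2 * S.an m (S.f^[n] (pr p)))
  have : ⌈2 * S.an (n + m) (pr p)⌉ ≤ ⌈2 * S.an n (pr p)⌉ + ⌈2 * S.an m (S.f^[n] (pr p))⌉ := by
    rw [Int.ceil_le]; push_cast; linarith
  exact_mod_cast this

lemma torsion_of (z : Ann) {L : ℝ} (h : Tendsto (fun n : ℕ => S.an n z / (n:ℝ)) atTop (𝓝 L)) :
    S.Torsion z L := by
  obtain ⟨p, rfl⟩ := pr_open.surjective z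
  refine ⟨p, rfl, fun w hw => ?_⟩
  obtain ⟨r, hr, θ, rfl⟩ := exists_polar hw
  refine ⟨fun n => S.An n p θ - θ, fun n _ => S.angleVar_An p hr θ n, ?_⟩
  have h2 : Tendsto (fun n : ℕ => (S.An n p θ - θ) / (n:ℝ) - S.an n (pr p) / (n:ℝ)) atTop (𝓝 0) := by
    refine squeeze_zero_norm (a := fun n : ℕ => (1/2 : ℝ) / n) (fun n => ?_)
      (tendsto_const_div_atTop_nhds_zero_nat _)
    rw [← sub_div, norm_div, Real.norm_eq_abs, Real.norm_eq_abs, Nat.abs_cast, an_pr]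
    have := S.An_quasi n p θ
    gcongr
    rwa [sub_right_comm] at this
  have := h2.add h
  simpa using this

end IsotopySetup

lemma restrict_pres {α : Type*} [MeasurableSpace α] {μ : Measure α} {T : α → α}
    (hT : MeasurePreserving T μ μ) {X : Set α} (hX : MeasurableSet X) (hfin : μ X ≠ ⊤)
    (hsub : X ⊆ T ⁻¹' X) : MeasurePreserving T (μ.restrict X) (μ.restrict X) := by
  have h1 := hT.restrict_preimage hX
  have h2 : X =ᵐ[μ] T ⁻¹' X := ae_eq_of_subset_of_measure_ge hsub
    (hT.measure_preimage hX.nullMeasurableSet).le hX.nullMeasurableSet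
    (by rw [hT.measure_preimage hX.nullMeasurableSet]; exact hfin)
  rwa [← Measure.restrict_congr_set h2] at h1

/-- Let `f` be a positive twist map preserving Lebesgue measure and `z₀ ∈ 𝔸`
a point with over-conjugate points admitting an open neighborhood `U` such that
`Leb(⋃_{n∈ℤ} fⁿ(U)) < ∞`. Then `z₀` has an open neighborhood `W ⊆ U` on which the asymptotic
torsion exists and is negative almost everywhere. -/
theorem statement5 (S : IsotopySetup) (htwist : S.PosTwist)
    (hpres : MeasurePreserving S.f volume volume)
    (z₀ : Ann) (hover : S.OverConj z₀)
    (U : Set Ann) (hUopen : IsOpen U) (hz₀U : z₀ ∈ U)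
    (hUfin : volume (⋃ n : ℤ, iterZ S.f n '' U) < ⊤) :
    ∃ W : Set Ann, IsOpen W ∧ W ⊆ U ∧ z₀ ∈ W ∧
      ∀ᵐ z ∂volume, z ∈ W → ∃ L : ℝ, S.Torsion z L ∧ L < 0 := by
  obtain ⟨p₀, rfl, N, hN1, a₀, ha₀, ha₀'⟩ := hover
  have e0 := S.angleVar_unique p₀ N ha₀
  rw [e0] at ha₀'
  obtain ⟨m, hm⟩ := S.twist_range htwist
  have hmneg : m ≤ -1 := by
    by_contra hcon
    have hm0 : (0:ℝ) ≤ m := by exact_mod_cast (by omega : 0 ≤ m)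
    have : ∀ n, 0 ≤ S.An n p₀ 0 := by
      intro n
      induction n with
      | zero => exact le_rfl
      | succ n ih =>
        have h1 := (S.phi_strictMono (S.F^[n] p₀)).monotone ih
        have h2 := (hm (S.F^[n] p₀)).1
        show 0 ≤ S.phi (S.F^[n] p₀) (S.An n p₀ 0)
        linarith
    have := this N
    linarith
  have hm1 : (m:ℝ) ≤ -1 := by exact_mod_cast hmneg
  have a1 : ∀ p, S.an 1 (pr p) = S.phi p 0 := fun p => S.an_pr 1 p
  have a1neg : ∀ z, S.an 1 z ≤ 0 := fun z => by
    obtain ⟨p, rfl⟩ := pr_open.surjective z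
    rw [a1]; have := (hm p).2; linarith
  have hB : ∀ z, |S.an 1 z| ≤ |(m:ℝ)| := fun z => by
    obtain ⟨p, rfl⟩ := pr_open.surjective z
    rw [a1, abs_of_neg (by have := (hm p).2; linarith), abs_of_neg (by linarith)]
    have := (hm p).1; linarith
  have h0 : ∀ z, S.an 0 z = 0 := fun z => rfl
  -- the forward saturation of `U`
  set X : Set Ann := ⋃ n : ℕ, S.f^[n] '' U with hXdef
  have hfo : ∀ n : ℕ, IsOpenMap (S.f^[n]) := by
    intro n
    induction n with
    | zero => exact IsOpenMap.id
    | succ n ih => rw [iterate_succ']; exact S.f_open.comp ih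
  have hXo : IsOpen X := isOpen_iUnion fun n => hfo n U hUopen
  have hXfin : volume X < ⊤ := by
    refine lt_of_le_of_lt (measure_mono ?_) hUfin
    exact iUnion_subset fun n => subset_iUnion (fun k : ℤ => iterZ S.f k '' U) (Int.ofNat n)
  have hXf : X ⊆ S.f ⁻¹' X := by
    intro z hz
    obtain ⟨n, y, hy, rfl⟩ := mem_iUnion.mp hz
    exact mem_iUnion.mpr ⟨n + 1, y, hy, iterate_succ_apply' _ _ _⟩
  have hUX : U ⊆ X := fun z hz => mem_iUnion.mpr ⟨0, z, hz, rfl⟩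
  have hT := restrict_pres hpres hXo.measurableSet hXfin.ne hXf
  have : IsFiniteMeasure ((volume : Measure Ann).restrict X) := ⟨by simpa using hXfin⟩
  set W : Set Ann := U ∩ {z | S.an N z < -1/2} with hWdef
  have hWo : IsOpen W := hUopen.inter (isOpen_lt (S.an_cont N) continuous_const)
  refine ⟨W, hWo, inter_subset_left, ⟨hz₀U, ?_⟩, ?_⟩
  · show S.an N (pr p₀) < -1/2
    rw [S.an_pr]; exact ha₀'
  have hconv : ∀ᵐ z ∂(volume.restrict X), ∀ k : ℕ, ∃ l,
      Tendsto (fun n => birkhoffAverage ℝ S.f (S.an k) n z) atTop (𝓝 l) := by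
    rw [ae_all_iff]
    intro k
    exact birkhoff_ae hT (S.an_cont k).measurable (quasi_bound S.an_quasi hB h0 k)
  have hret := birkhoff_return hT hWo.measurableSet
  have hboth := hconv.and hret
  rw [ae_restrict_iff' hXo.measurableSet] at hboth
  filter_upwards [hboth] with z hz hzW
  obtain ⟨hc, hr⟩ := hz (hUX hzW.1)
  obtain ⟨l, hl0, hl⟩ := hr hzW
  obtain ⟨L, hL⟩ := quasi_conv S.an_quasi hB h0 z hc
  refine ⟨L, S.torsion_of z hL, ?_⟩
  have hN0 : (0:ℝ) < N := by exact_mod_cast hN1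
  have hkey : ∀ n : ℕ, 2 * N * S.an (n + N) z ≤
      - birkhoffSum S.f (W.indicator (fun _ => (1:ℝ))) n z := by
    intro n
    have h1 := subadd_neg (T := S.f) (b := fun n z => ((⌈2 * S.an n z⌉ : ℤ) : ℝ)) S.an_ceil
      (fun x => by simp [h0]) (fun x => by
        have : ⌈2 * S.an 1 x⌉ ≤ 0 := by rw [Int.ceil_le]; have := a1neg x; push_cast; linarith
        exact_mod_cast this) (W := W) (N := N) (fun x hx => by
        have hx2 : S.an N x < -1/2 := hx.2
        have : ⌈2 * S.an N x⌉ ≤ -1 := by rw [Int.ceil_le]; push_cast; linarith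
        exact_mod_cast this) n z
    have h2 := Int.le_ceil (2 * S.an (n + N) z)
    refine le_trans ?_ h1
    have := mul_le_mul_of_nonneg_left h2 hN0.le
    linarith
  -- pass to the limit
  have hshift : Tendsto (fun n : ℕ => S.an (n + N) z / ((n + N : ℕ):ℝ)) atTop (𝓝 L) :=
    hL.comp (tendsto_add_atTop_nat N)
  have hratio : Tendsto (fun n : ℕ => ((n + N : ℕ):ℝ) / (n:ℝ)) atTop (𝓝 1) := by
    have h1 : Tendsto (fun n : ℕ => 1 + (N:ℝ) / (n:ℝ)) atTop (𝓝 (1 + 0)) :=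
      tendsto_const_nhds.add (tendsto_const_div_atTop_nhds_zero_nat _)
    rw [add_zero] at h1
    refine h1.congr' ?_
    filter_upwards [eventually_gt_atTop 0] with n hn
    have : (0:ℝ) < n := by exact_mod_cast hn
    push_cast; field_simp
  have hlim := (hshift.mul hratio).const_mul (2 * (N:ℝ))
  have hle : 2 * (N:ℝ) * (L * 1) ≤ -l := by
    refine le_of_tendsto_of_tendsto hlim hl.neg ?_
    filter_upwards [eventually_gt_atTop 0] with n hn
    have hn0 : (0:ℝ) < n := by exact_mod_cast hn
    have hnN : (0:ℝ) < ((n + N : ℕ):ℝ) := by push_cast; linarith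
    rw [birkhoffAverage, smul_eq_mul]
    have e : 2 * (N:ℝ) * (S.an (n + N) z / ((n + N : ℕ):ℝ) * (((n + N : ℕ):ℝ) / (n:ℝ)))
        = (n:ℝ)⁻¹ * (2 * N * S.an (n + N) z) := by field_simp
    rw [e, ← mul_neg]
    exact mul_le_mul_of_nonneg_left (hkey n) (by positivity)
  by_contra hcon
  have : 0 ≤ 2 * (N:ℝ) * (L * 1) := by
    have : 0 ≤ L := not_lt.mp hcon
    positivity
  linarith

end
end

section
/- Let f : 𝔸 → 𝔸 be a positive twist map. Then there exists a point z ∈ 𝔸 with conjugate points if and only if there exists a point z' ∈ 𝔸 with over-conjugate points. -/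
noncomputable section

open MeasureTheory Set Filter Topology Function

/-- Unit vector at angle `2πθ` counted from the vertical. -/
def ee (θ : ℝ) : Pl := (-Real.sin (2 * Real.pi * θ), Real.cos (2 * Real.pi * θ))

/-- `g` is a positive multiple of `ee θ`. -/
def Dir (g : Pl) (θ : ℝ) : Prop := ∃ r : ℝ, 0 < r ∧ g = r • ee θ

lemma continuous_ee : Continuous ee := by unfold ee; fun_prop

lemma ee_ne (θ : ℝ) : ee θ ≠ 0 := by
  intro h
  have h1 := congrArg Prod.fst h
  have h2 := congrArg Prod.snd h
  simp only [ee, Prod.fst_zero, Prod.snd_zero] at h1 h2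
  have := Real.sin_sq_add_cos_sq (2 * Real.pi * θ)
  rw [h2, neg_eq_zero.mp h1] at this
  norm_num at this

lemma ee_zero : ee 0 = (0, 1) := by simp [ee]

lemma ee_quarter : ee (-1/4) = (1, 0) := by
  have : 2 * Real.pi * (-1/4) = -(Real.pi / 2) := by ring
  simp [ee, this]

lemma ee_half (θ : ℝ) : ee (θ - 1/2) = - ee θ := by
  have : 2 * Real.pi * (θ - 1/2) = 2 * Real.pi * θ - Real.pi := by ring
  simp only [ee, this, Real.sin_sub_pi, Real.cos_sub_pi, Prod.neg_mk]

lemma dir_unique {g : Pl} {a b : ℝ} (ha : Dir g a) (hb : Dir g b) : ∃ k : ℤ, a - b = k := by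
  obtain ⟨r, hr, h1⟩ := ha
  obtain ⟨q, hq, h2⟩ := hb
  rw [h1] at h2
  have e1 := congrArg Prod.fst h2
  have e2 := congrArg Prod.snd h2
  simp only [ee, Prod.smul_fst, Prod.smul_snd, smul_eq_mul] at e1 e2
  have s1 := Real.sin_sq_add_cos_sq (2 * Real.pi * a)
  have s2 := Real.sin_sq_add_cos_sq (2 * Real.pi * b)
  have hrq : r ^ 2 = q ^ 2 := by
    have t1 : r ^ 2 = (r * -Real.sin (2 * Real.pi * a)) ^ 2 + (r * Real.cos (2 * Real.pi * a)) ^ 2 := by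
      linear_combination (-r ^ 2) * s1
    have t2 : q ^ 2 = (q * -Real.sin (2 * Real.pi * b)) ^ 2 + (q * Real.cos (2 * Real.pi * b)) ^ 2 := by
      linear_combination (-q ^ 2) * s2
    rw [t1, t2, e1, e2]
  have hrq' : r = q := by
    rcases sq_eq_sq_iff_eq_or_eq_neg.mp hrq with h | h
    · exact h
    · linarith
  subst hrq'
  have c1 : Real.sin (2 * Real.pi * a) = Real.sin (2 * Real.pi * b) := by
    have := mul_left_cancel₀ hr.ne' e1
    linarith
  have c2 := mul_left_cancel₀ hr.ne' e2
  obtain ⟨k, hk⟩ := Real.Angle.angle_eq_iff_two_pi_dvd_sub.mp (Real.Angle.cos_sin_inj c2 c1)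
  refine ⟨k, ?_⟩
  have hpi : 2 * Real.pi ≠ 0 := by positivity
  apply mul_left_cancel₀ hpi
  linarith

lemma dir_const {X : Type*} [TopologicalSpace X] {s : Set X} (hs : IsPreconnected s)
    {g : X → Pl} {a b : X → ℝ} (ha : ContinuousOn a s) (hb : ContinuousOn b s)
    (hga : ∀ x ∈ s, Dir (g x) (a x)) (hgb : ∀ x ∈ s, Dir (g x) (b x))
    {x y : X} (hx : x ∈ s) (hy : y ∈ s) : a x - b x = a y - b y := by
  have : DiscreteTopology (range ((↑) : ℤ → ℝ)) :=
    (Int.isClosedEmbedding_coe_real.toIsEmbedding.toHomeomorph).symm.isEmbedding.discreteTopology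
  refine hs.constant_of_mapsTo (T := range ((↑) : ℤ → ℝ)) (f := fun x => a x - b x)
    ⟨this⟩ (ha.sub hb) ?_ hx hy
  intro z hz
  obtain ⟨k, hk⟩ := dir_unique (hga z hz) (hgb z hz)
  exact ⟨k, hk.symm⟩

lemma exists_lift {X : Type*} [AddCommGroup X] [Module ℝ X] [TopologicalSpace X]
    [ContinuousAdd X] [ContinuousSMul ℝ X] [LocallyPathConnectedSpace X]
    (g : X → Pl) (hg : Continuous g) (h0 : ∀ x, g x ≠ 0) :
    ∃ θ : X → ℝ, Continuous θ ∧ ∀ x, Dir (g x) (θ x) := by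
  let f : C(X, ℂ) := ⟨fun x => ⟨(g x).2, -(g x).1⟩, by
    have : (fun x => (⟨(g x).2, -(g x).1⟩ : ℂ)) =
        fun x => ((g x).2 : ℂ) + (-(g x).1 : ℝ) * Complex.I := by
      funext x; apply Complex.ext <;> simp
    rw [this]; fun_prop⟩
  have hs : ∀ a, f a ∈ ({0}ᶜ : Set ℂ) := by
    intro a ha
    have ha : f a = 0 := ha
    apply h0 a
    have h1 := congrArg Complex.re ha
    have h2 := congrArg Complex.im ha
    simp only [f, ContinuousMap.coe_mk, Complex.zero_re, Complex.zero_im, neg_eq_zero] at h1 h2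
    exact Prod.ext h2 h1
  have : SimplyConnectedSpace X := inferInstance
  obtain ⟨L, ⟨-, hL⟩, -⟩ := Complex.isCoveringMapOn_exp.existsUnique_continuousMap_lifts f (a₀ := 0)
    (e₀ := Complex.log (f 0)) (Complex.exp_log (hs 0)) hs
  refine ⟨fun x => (L x).im / (2 * Real.pi), by fun_prop, fun x => ⟨Real.exp (L x).re,
    Real.exp_pos _, ?_⟩⟩
  have hx : Complex.exp (L x) = f x := congrFun hL x
  have hpi : 2 * Real.pi * ((L x).im / (2 * Real.pi)) = (L x).im := by field_simp
  have h1 := congrArg Complex.re hx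
  have h2 := congrArg Complex.im hx
  simp only [f, ContinuousMap.coe_mk, Complex.exp_re, Complex.exp_im] at h1 h2
  simp only [ee, hpi]
  apply Prod.ext
  · simp; linarith
  · simp; linarith

/-- A lifted isotopy of the plane, for all times. -/
structure Good (Φ : ℝ → Pl → Pl) : Prop where
  cont : Continuous (fun q : ℝ × Pl => Φ q.1 q.2)
  diff : ∀ t, Differentiable ℝ (Φ t)
  dcont : Continuous (fun q : ℝ × Pl => fderiv ℝ (Φ q.1) q.2)
  inj : ∀ t, Injective (Φ t)
  dinj : ∀ t p w, fderiv ℝ (Φ t) p w = 0 → w = 0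
  per : ∀ t p, Φ t (p + (1, 0)) = Φ t p + (1, 0)
  zero : Φ 0 = id

/-- Parameter space for chords: time, base point, angle, length. -/
abbrev Par : Type := ℝ × Pl × ℝ × ℝ

/-- The normalised chord. -/
def chord (Φ : ℝ → Pl → Pl) (q : Par) : Pl :=
  ∫ σ in (0:ℝ)..1, fderiv ℝ (Φ q.1) (q.2.1 + (σ * q.2.2.2) • ee q.2.2.1) (ee q.2.2.1)

lemma Good.cont_aux {Φ : ℝ → Pl → Pl} (hΦ : Good Φ) : Continuous (uncurry fun (q : Par) (σ : ℝ) =>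
    fderiv ℝ (Φ q.1) (q.2.1 + (σ * q.2.2.2) • ee q.2.2.1) (ee q.2.2.1)) := by
  have h := continuous_ee
  refine Continuous.clm_apply (hΦ.dcont.comp (g := fun q : ℝ × Pl => fderiv ℝ (Φ q.1) q.2)
    (f := fun x : Par × ℝ => (x.1.1, x.1.2.1 + (x.2 * x.1.2.2.2) • ee x.1.2.2.1)) ?_) ?_ <;> fun_prop

lemma Good.chord_cont {Φ : ℝ → Pl → Pl} (hΦ : Good Φ) : Continuous (chord Φ) :=
  intervalIntegral.continuous_parametric_intervalIntegral_of_continuous' hΦ.cont_aux 0 1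

lemma Good.chord_smul {Φ : ℝ → Pl → Pl} (hΦ : Good Φ) (t : ℝ) (p : Pl) (α s : ℝ) :
    s • chord Φ (t, p, α, s) = Φ t (p + s • ee α) - Φ t p := by
  have hd : ∀ σ : ℝ, HasDerivAt (fun σ : ℝ => Φ t (p + (σ * s) • ee α))
      (s • fderiv ℝ (Φ t) (p + (σ * s) • ee α) (ee α)) σ := by
    intro σ
    have h1 : HasDerivAt (fun σ : ℝ => p + (σ * s) • ee α) (s • ee α) σ := by
      have := (((hasDerivAt_id σ).mul_const s).smul_const (ee α)).const_add p
      simpa using this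
    have := (hΦ.diff t (p + (σ * s) • ee α)).hasFDerivAt.comp_hasDerivAt σ h1
    rw [map_smul] at this
    exact this
  have hc : Continuous fun σ : ℝ => fderiv ℝ (Φ t) (p + (σ * s) • ee α) (ee α) :=
    hΦ.cont_aux.comp (f := fun σ : ℝ => (((t, p, α, s) : Par), σ)) (by fun_prop)
  have := intervalIntegral.integral_eq_sub_of_hasDerivAt (a := 0) (b := 1) (fun σ _ => hd σ)
    ((hc.const_smul s).intervalIntegrable 0 1)
  rw [intervalIntegral.integral_smul] at this
  simpa [chord] using this

lemma chord_zero {Φ : ℝ → Pl → Pl} (t : ℝ) (p : Pl) (α : ℝ) :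
    chord Φ (t, p, α, 0) = fderiv ℝ (Φ t) p (ee α) := by
  simp [chord]

lemma Good.chord_ne {Φ : ℝ → Pl → Pl} (hΦ : Good Φ) (q : Par) : chord Φ q ≠ 0 := by
  obtain ⟨t, p, α, s⟩ := q
  intro h
  by_cases hs : s = 0
  · subst hs
    rw [chord_zero] at h
    exact ee_ne _ (hΦ.dinj _ _ _ h)
  · have := hΦ.chord_smul t p α s
    rw [h, smul_zero, eq_comm, sub_eq_zero] at this
    have := hΦ.inj t this
    simp [hs, ee_ne] at this

lemma Good.chord_time_zero {Φ : ℝ → Pl → Pl} (hΦ : Good Φ) (p : Pl) (α s : ℝ) : chord Φ (0, p, α, s) = ee α := by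
  simp [chord, hΦ.zero]

lemma Good.chord_hor {Φ : ℝ → Pl → Pl} (hΦ : Good Φ) (t : ℝ) (p : Pl) : chord Φ (t, p, -1/4, 1) = ee (-1/4) := by
  have := hΦ.chord_smul t p (-1/4) 1
  rw [one_smul, one_smul, ee_quarter, hΦ.per, add_sub_cancel_left] at this
  rw [this, ee_quarter]


lemma dir_ee (α : ℝ) : Dir (ee α) α := ⟨1, one_pos, by simp⟩

/-- The global angle function of an isotopy. -/
lemma Good.exists_angle {Φ : ℝ → Pl → Pl} (hΦ : Good Φ) :
    ∃ Θ : Par → ℝ, Continuous Θ ∧ (∀ q, Dir (chord Φ q) (Θ q)) ∧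
      (∀ p α s, Θ (0, p, α, s) = α) ∧ (∀ t p, Θ (t, p, -1/4, 1) = -1/4) := by
  obtain ⟨θ, hθ, hd⟩ := exists_lift (chord Φ) hΦ.chord_cont hΦ.chord_ne
  obtain ⟨k, hk⟩ := dir_unique (hd (0, 0, 0, 0)) (b := 0) (by
    rw [hΦ.chord_time_zero]; exact dir_ee 0)
  have key : ∀ p α s, θ (0, p, α, s) - α = k := by
    intro p α s
    have := dir_const (s := (univ : Set (Pl × ℝ × ℝ))) isPreconnected_univ
      (g := fun q => chord Φ (0, q)) (a := fun q => θ (0, q)) (b := fun q => q.2.1)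
      (by fun_prop) (by fun_prop) (fun q _ => hd _)
      (fun q _ => by rw [hΦ.chord_time_zero]; exact dir_ee _)
      (mem_univ (p, α, s)) (mem_univ (0, 0, 0))
    simp only [] at this
    rw [this, ← hk]
  refine ⟨fun q => θ q - k, by fun_prop, fun q => ?_, fun p α s => ?_, fun t p => ?_⟩
  · obtain ⟨r, hr, h⟩ := hd q
    refine ⟨r, hr, ?_⟩
    rw [h]
    congr 1
    have : 2 * Real.pi * (θ q - k) = 2 * Real.pi * θ q - k * (2 * Real.pi) := by ring
    simp only [ee, this, Real.sin_sub_int_mul_two_pi, Real.cos_sub_int_mul_two_pi]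
  · linarith [key p α s]
  · have := dir_const (s := (univ : Set ℝ)) isPreconnected_univ
      (g := fun t => chord Φ (t, p, -1/4, 1)) (a := fun t => θ (t, p, -1/4, 1))
      (b := fun _ => -1/4)
      (by fun_prop) (by fun_prop) (fun q _ => hd _)
      (fun q _ => by rw [hΦ.chord_hor]; exact dir_ee _)
      (mem_univ t) (mem_univ 0)
    linarith [key p (-1/4) 1]

lemma sin_neg_of_dir {g : Pl} {θ : ℝ} (h : Dir g θ) (hg : 0 < g.1) :
    Real.sin (2 * Real.pi * θ) < 0 := by
  obtain ⟨r, hr, rfl⟩ := h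
  simp only [ee, Prod.smul_fst, smul_eq_mul] at hg
  have := (mul_pos_iff_of_pos_left hr).mp hg
  linarith

lemma cos_nonneg_of_dir {g : Pl} {θ : ℝ} (h : Dir g θ) (hg : 0 ≤ g.2) :
    0 ≤ Real.cos (2 * Real.pi * θ) := by
  obtain ⟨r, hr, rfl⟩ := h
  simp only [ee, Prod.smul_snd, smul_eq_mul] at hg
  exact nonneg_of_mul_nonneg_right hg hr

/-- A continuous angle staying in the open right half plane keeps its sector. -/
lemma sector_right {X : Type*} [TopologicalSpace X] {s : Set X} (hs : IsPreconnected s)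
    {ψ : X → ℝ} (hψ : ContinuousOn ψ s) (h : ∀ x ∈ s, Real.sin (2 * Real.pi * ψ x) < 0)
    {x y : X} (hx : x ∈ s) (hy : y ∈ s) (h0 : ψ x < 0) : ψ y < 0 := by
  by_contra hcon
  obtain ⟨z, hz, hz'⟩ := hs.intermediate_value hx hy hψ ⟨h0.le, not_lt.mp hcon⟩
  have := h z hz
  rw [hz'] at this
  simp at this

/-- A continuous angle staying in the closed upper half plane keeps its sector. -/
lemma sector_up {X : Type*} [TopologicalSpace X] {s : Set X} (hs : IsPreconnected s)
    {ψ : X → ℝ} (hψ : ContinuousOn ψ s) (h : ∀ x ∈ s, 0 ≤ Real.cos (2 * Real.pi * ψ x))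
    {x y : X} (hx : x ∈ s) (hy : y ∈ s) (h0 : -1/4 ≤ ψ x) : -1/4 ≤ ψ y := by
  by_contra hcon
  have hcon := not_le.mp hcon
  have hm : max (ψ y) (-1/2) < -1/4 := max_lt hcon (by norm_num)
  obtain ⟨z, hz, hz'⟩ := hs.intermediate_value hy hx hψ
    ⟨le_max_left (ψ y) (-1/2), hm.le.trans h0⟩
  have := h z hz
  rw [hz'] at this
  set m := max (ψ y) (-1/2)
  have hm2 : -1/2 ≤ m := le_max_right _ _
  have hpi := Real.pi_pos
  have : Real.cos (2 * Real.pi * m) < 0 := by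
    rw [← Real.cos_neg]
    apply Real.cos_neg_of_pi_div_two_lt_of_lt
    · nlinarith
    · nlinarith
  linarith

/-- At every time some point has torsion of the vertical at least `-1/4`. -/
lemma Good.exists_large {Φ : ℝ → Pl → Pl} (hΦ : Good Φ) {Θ : Par → ℝ} (hc : Continuous Θ)
    (hd : ∀ q, Dir (chord Φ q) (Θ q)) (h0 : ∀ p α s, Θ (0, p, α, s) = α)
    (h1 : ∀ t p, Θ (t, p, -1/4, 1) = -1/4) (T : ℝ) : ∃ p, -1/4 ≤ Θ (T, p, 0, 0) := by
  have hcont : Continuous fun x : ℝ => (Φ T (x, 0)).2 :=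
    (hΦ.cont.comp (f := fun x : ℝ => (T, ((x, 0) : Pl))) (by fun_prop)).snd
  obtain ⟨x, hx, hmin⟩ := isCompact_Icc.exists_isMinOn (s := Icc (0:ℝ) 1) ⟨0, by simp⟩
    hcont.continuousOn
  have hmin' : ∀ s ∈ Icc (0:ℝ) 1, (Φ T (x, 0)).2 ≤ (Φ T (x + s, 0)).2 := by
    intro s hs
    by_cases h : x + s ≤ 1
    · exact hmin ⟨add_nonneg hx.1 hs.1, h⟩
    · have e : ((x + s, 0) : Pl) = (x + s - 1, 0) + (1, 0) := by simp
      rw [e, hΦ.per]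
      have : (Φ T (x, 0)).2 ≤ (Φ T (x + s - 1, 0)).2 :=
        hmin ⟨by linarith, by linarith [hx.2, hs.2]⟩
      simpa using this
  have hup : ∀ s ∈ Ioc (0:ℝ) 1, 0 ≤ (chord Φ (T, (x, 0), -1/4, s)).2 := by
    intro s hs
    have := congrArg Prod.snd (hΦ.chord_smul T (x, 0) (-1/4) s)
    rw [ee_quarter] at this
    simp only [Prod.smul_snd, smul_eq_mul, Prod.snd_sub, Prod.smul_mk, mul_one, mul_zero,
      Prod.mk_add_mk, add_zero] at this
    have h2 := hmin' s ⟨hs.1.le, hs.2⟩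
    have : 0 ≤ s * (chord Φ (T, (x, 0), -1/4, s)).2 := by rw [this]; linarith
    exact nonneg_of_mul_nonneg_right this hs.1
  have hcc : Continuous fun s : ℝ => (chord Φ (T, (x, 0), -1/4, s)).2 :=
    (hΦ.chord_cont.comp (f := fun s : ℝ => ((T, (x, 0), -1/4, s) : Par)) (by fun_prop)).snd
  have hup' : ∀ s ∈ Icc (0:ℝ) 1, 0 ≤ (chord Φ (T, (x, 0), -1/4, s)).2 := by
    have hcl : IsClosed {s : ℝ | 0 ≤ (chord Φ (T, (x, 0), -1/4, s)).2} :=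
      isClosed_le continuous_const hcc
    have := hcl.closure_subset_iff.mpr (fun s hs => hup s hs)
    rw [closure_Ioc (by norm_num)] at this
    exact this
  have hA : -1/4 ≤ Θ (T, (x, 0), -1/4, 0) :=
    sector_up (ψ := fun s => Θ (T, (x, 0), -1/4, s)) (isPreconnected_Icc (a := (0:ℝ)) (b := 1))
      (Continuous.continuousOn (by fun_prop)) (fun s hs => cos_nonneg_of_dir (hd _) (hup' s hs))
      (x := 1) (y := 0) (by simp) (by simp) (h1 _ _).ge
  refine ⟨(x, 0), hA.trans ?_⟩
  by_contra hcon
  have hcon := not_le.mp hcon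
  obtain ⟨t, -, ht⟩ := (isPreconnected_univ (α := ℝ)).intermediate_value (mem_univ T) (mem_univ 0)
    (f := fun t => Θ (t, (x, 0), 0, 0) - Θ (t, (x, 0), -1/4, 0))
    (Continuous.continuousOn (by fun_prop))
    (show (0:ℝ) ∈ _ from ⟨by linarith, by simp only [h0]; norm_num⟩)
  obtain ⟨r, hr, e1⟩ := hd (t, (x, 0), 0, 0)
  obtain ⟨q, hq, e2⟩ := hd (t, (x, 0), -1/4, 0)
  rw [chord_zero] at e1 e2
  rw [sub_eq_zero.mp ht] at e1
  have : fderiv ℝ (Φ t) (x, 0) (q • ee 0 - r • ee (-1/4)) = 0 := by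
    rw [map_sub, map_smul, map_smul, e1, e2, smul_smul, smul_smul, mul_comm, sub_self]
  have := congrArg Prod.snd (hΦ.dinj _ _ _ this)
  rw [ee_zero, ee_quarter] at this
  simp at this
  exact hq.ne' this

/-- Torsion at time one is negative for a twist. -/
lemma Good.twist_neg {Φ : ℝ → Pl → Pl} (hΦ : Good Φ) {Θ : Par → ℝ} (hc : Continuous Θ)
    (hd : ∀ q, Dir (chord Φ q) (Θ q)) (h1 : ∀ t p, Θ (t, p, -1/4, 1) = -1/4) (T : ℝ)
    (htw : ∀ x : ℝ, StrictMono (fun y => (Φ T (x, y)).1) ∧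
      Function.Surjective (fun y => (Φ T (x, y)).1) ∧
      ∀ y : ℝ, 0 < deriv (fun y => (Φ T (x, y)).1) y) (p : Pl) : Θ (T, p, 0, 0) < 0 := by
  obtain ⟨x, y⟩ := p
  have hcT : Continuous (Φ T) := (hΦ.diff T).continuous
  -- a uniform height
  obtain ⟨B, hB0, hB⟩ : ∃ B : ℝ, 0 < B ∧ ∀ a ∈ Icc (0:ℝ) 1,
      (Φ T (x, y)).1 < (Φ T (x + a, y + B)).1 := by
    obtain ⟨n, hn⟩ := (isCompact_Icc (a := (0:ℝ)) (b := 1)).elim_directed_cover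
      (fun n : ℕ => {a : ℝ | (Φ T (x, y)).1 < (Φ T (x + a, y + n)).1})
      (fun n => isOpen_lt continuous_const (by fun_prop))
      (by
        intro a _
        obtain ⟨b, hb⟩ := (htw (x + a)).2.1 ((Φ T (x, y)).1 + 1)
        obtain ⟨n, hn⟩ := exists_nat_ge (b - y)
        refine mem_iUnion.mpr ⟨n, ?_⟩
        have : (Φ T (x + a, b)).1 ≤ (Φ T (x + a, y + n)).1 :=
          (htw (x + a)).1.monotone (by linarith)
        simp only [] at hb
        show (Φ T (x, y)).1 < _
        linarith)
      (directed_of_isDirected_le (by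
        intro m n hmn a ha
        refine lt_of_lt_of_le ha ((htw (x + a)).1.monotone ?_)
        have : (m:ℝ) ≤ n := by exact_mod_cast hmn
        linarith))
    refine ⟨n + 1, by positivity, fun a ha => lt_of_lt_of_le (hn ha) ((htw (x + a)).1.monotone ?_)⟩
    linarith
  -- polar coordinates of the displacement `(a,b)`
  let α : ℝ × ℝ → ℝ := fun q => - Complex.arg ⟨q.2, q.1⟩ / (2 * Real.pi)
  let ρ : ℝ × ℝ → ℝ := fun q => ‖(⟨q.2, q.1⟩ : ℂ)‖
  have hmk : Continuous fun q : ℝ × ℝ => (⟨q.2, q.1⟩ : ℂ) := by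
    have : (fun q : ℝ × ℝ => (⟨q.2, q.1⟩ : ℂ)) = fun q => (q.2 : ℂ) + q.1 * Complex.I := by
      funext q; apply Complex.ext <;> simp
    rw [this]; fun_prop
  have hpol : ∀ q, ρ q • ee (α q) = q := by
    rintro ⟨a, b⟩
    have e : 2 * Real.pi * (- Complex.arg ⟨b, a⟩ / (2 * Real.pi)) = - Complex.arg ⟨b, a⟩ := by
      field_simp
    simp only [ρ, α, ee, e, Real.sin_neg, Real.cos_neg, neg_neg]
    apply Prod.ext
    · simp [Complex.norm_mul_sin_arg]
    · simp [Complex.norm_mul_cos_arg]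
  let K : Set (ℝ × ℝ) := {q | (0 < q.1 ∨ 0 < q.2) ∧ (Φ T (x, y)).1 < (Φ T (x + q.1, y + q.2)).1}
  have hψ : ContinuousOn (fun q => Θ (T, (x, y), α q, ρ q)) K := by
    have hρ : Continuous ρ := hmk.norm
    have hα : ContinuousOn α K := by
      intro q hq
      apply ContinuousAt.continuousWithinAt
      have : ContinuousAt (fun q : ℝ × ℝ => Complex.arg ⟨q.2, q.1⟩) q :=
        (Complex.continuousAt_arg (x := ⟨q.2, q.1⟩) (by
          rcases hq.1 with h | h
          · right; exact h.ne'
          · left; exact h)).comp (f := fun q : ℝ × ℝ => (⟨q.2, q.1⟩ : ℂ)) hmk.continuousAt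
      exact this.neg.div_const _
    exact hc.comp_continuousOn (f := fun q => ((T, (x, y), α q, ρ q) : Par))
      (continuousOn_const.prodMk (continuousOn_const.prodMk (hα.prodMk hρ.continuousOn)))
  have hsin : ∀ q ∈ K, Real.sin (2 * Real.pi * Θ (T, (x, y), α q, ρ q)) < 0 := by
    intro q hq
    apply sin_neg_of_dir (hd _)
    have hρ0 : 0 < ρ q := by
      apply norm_pos_iff.mpr
      intro h
      have h1 := congrArg Complex.re h
      have h2 := congrArg Complex.im h
      simp only [Complex.zero_re, Complex.zero_im] at h1 h2
      rcases hq.1 with h | h <;> linarith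
    have := congrArg Prod.fst (hΦ.chord_smul T (x, y) (α q) (ρ q))
    rw [hpol] at this
    simp only [Prod.smul_fst, smul_eq_mul, Prod.fst_sub] at this
    have h2 : 0 < ρ q * (chord Φ (T, (x, y), α q, ρ q)).1 := by
      rw [this]
      exact sub_pos.mpr hq.2
    exact (mul_pos_iff_of_pos_left hρ0).mp h2
  have hstart : Θ (T, (x, y), α (1, 0), ρ (1, 0)) < 0 := by
    have e1 : (⟨0, 1⟩ : ℂ) = Complex.I := rfl
    have e2 : α (1, 0) = -1/4 := by
      simp only [α, e1, Complex.arg_I]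
      field_simp
      norm_num
    have e3 : ρ (1, 0) = 1 := by simp only [ρ, e1, Complex.norm_I]
    rw [e2, e3, h1]; norm_num
  -- first segment
  have hs1 : Θ (T, (x, y), α (1, B), ρ (1, B)) < 0 := by
    have hpre : IsPreconnected ((fun b : ℝ => ((1:ℝ), b)) '' Icc 0 B) :=
      isPreconnected_Icc.image _ (by fun_prop)
    have hsub : ((fun b : ℝ => ((1:ℝ), b)) '' Icc 0 B) ⊆ K := by
      rintro _ ⟨b, hb, rfl⟩
      refine ⟨Or.inl one_pos, ?_⟩
      have e : ((x + 1, y + b) : Pl) = (x, y + b) + (1, 0) := by simp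
      have : (Φ T (x, y)).1 ≤ (Φ T (x, y + b)).1 := (htw x).1.monotone (by linarith [hb.1])
      simp only [e, hΦ.per, Prod.fst_add]
      linarith
    exact sector_right hpre (hψ.mono hsub) (fun q hq => hsin q (hsub hq))
      (x := ((1:ℝ), (0:ℝ))) (y := (1, B)) ⟨0, by simp [hB0.le], rfl⟩ ⟨B, by simp [hB0.le], rfl⟩ hstart
  have hs2 : Θ (T, (x, y), α (0, B), ρ (0, B)) < 0 := by
    have hpre : IsPreconnected ((fun a : ℝ => (a, B)) '' Icc 0 1) :=
      isPreconnected_Icc.image _ (by fun_prop)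
    have hsub : ((fun a : ℝ => (a, B)) '' Icc 0 1) ⊆ K := by
      rintro _ ⟨a, ha, rfl⟩
      exact ⟨Or.inr hB0, hB a ha⟩
    exact sector_right hpre (hψ.mono hsub) (fun q hq => hsin q (hsub hq))
      (x := ((1:ℝ), B)) (y := (0, B)) ⟨1, by simp, rfl⟩ ⟨0, by simp, rfl⟩ hs1
  have e2 : α (0, B) = 0 := by
    have : (⟨B, 0⟩ : ℂ) = ((B : ℝ) : ℂ) := rfl
    simp only [α, this, Complex.arg_ofReal_of_nonneg hB0.le]; simp
  have e3 : ρ (0, B) = B := by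
    have : (⟨B, 0⟩ : ℂ) = ((B : ℝ) : ℂ) := rfl
    simp only [ρ, this, Complex.norm_of_nonneg hB0.le]
  rw [e2, e3] at hs2
  refine sector_right (isPreconnected_Icc (a := (0:ℝ)) (b := B))
    (ψ := fun s => Θ (T, (x, y), 0, s)) (Continuous.continuousOn (by fun_prop)) ?_
    (x := B) (y := 0) (by simp [hB0.le]) (by simp [hB0.le]) hs2
  intro s hs
  apply sin_neg_of_dir (hd _)
  rcases hs.1.eq_or_lt with h | h
  · subst h
    rw [chord_zero, ee_zero]
    have hder : HasDerivAt (fun y => Φ T (x, y)) (fderiv ℝ (Φ T) (x, y) (0, 1)) y := by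
      have h1 : HasDerivAt (fun y : ℝ => ((x, y) : Pl)) (0, 1) y :=
        (hasDerivAt_const y x).prodMk (hasDerivAt_id y)
      exact (hΦ.diff T (x, y)).hasFDerivAt.comp_hasDerivAt y h1
    have h3 := (htw x).2.2 y
    have h4 : HasDerivAt (fun y => (Φ T (x, y)).1) (fderiv ℝ (Φ T) (x, y) (0, 1)).1 y :=
      (ContinuousLinearMap.fst ℝ ℝ ℝ).hasFDerivAt.comp_hasDerivAt y hder
    rwa [h4.deriv] at h3
  · have := congrArg Prod.fst (hΦ.chord_smul T (x, y) 0 s)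
    rw [ee_zero] at this
    simp only [Prod.smul_fst, smul_eq_mul, Prod.fst_sub, Prod.smul_mk, mul_zero, mul_one,
      Prod.mk_add_mk, add_zero] at this
    have h2 : 0 < s * (chord Φ (T, (x, y), 0, s)).1 := by
      rw [this]
      exact sub_pos.mpr ((htw x).1 (by linarith))
    exact (mul_pos_iff_of_pos_left h).mp h2

/-- Clamp to `[0,1]`. -/
def cl (t : ℝ) : ℝ := max 0 (min 1 t)

lemma continuous_cl : Continuous cl := by unfold cl; fun_prop

lemma cl_mem (t : ℝ) : cl t ∈ Icc (0:ℝ) 1 :=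
  ⟨le_max_left _ _, max_le zero_le_one (min_le_left _ _)⟩

lemma cl_of_le {t : ℝ} (h : t ≤ 0) : cl t = 0 :=
  max_eq_left ((min_le_right _ _).trans h)

lemma cl_of_ge {t : ℝ} (h : 1 ≤ t) : cl t = 1 := by
  simp [cl, min_eq_left h]

lemma cl_of_mem {t : ℝ} (h0 : 0 ≤ t) (h : t ≤ 1) : cl t = t := by
  simp [cl, min_eq_right h, h0]

/-- The extended isotopy, valid for times in `[0,N]`. -/
def isoExt (S : IsotopySetup) : ℕ → ℝ → Pl → Pl
  | 0 => fun _ p => p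
  | N + 1 => fun t p => S.Ft (cl (t - N)) (isoExt S N t p)

lemma good_ext (S : IsotopySetup) (N : ℕ) : Good (isoExt S N) := by
  induction N with
  | zero =>
    refine ⟨continuous_snd, fun t => differentiable_id, ?_, fun t => injective_id, ?_,
      fun t p => rfl, rfl⟩
    · have : (fun q : ℝ × Pl => fderiv ℝ (isoExt S 0 q.1) q.2) =
          fun _ => ContinuousLinearMap.id ℝ Pl := by
        funext q
        exact fderiv_id
      rw [this]; exact continuous_const
    · intro t p w h
      have : fderiv ℝ (isoExt S 0 t) p = ContinuousLinearMap.id ℝ Pl := fderiv_id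
      rw [this] at h
      exact h
  | succ N ih =>
    have hdF : ∀ t, Differentiable ℝ (S.Ft (cl t)) := fun t =>
      (S.Ft_smooth _ (cl_mem t)).differentiable (by norm_num)
    have hfd : ∀ t p, fderiv ℝ (isoExt S (N + 1) t) p =
        (fderiv ℝ (S.Ft (cl (t - N))) (isoExt S N t p)).comp (fderiv ℝ (isoExt S N t) p) := fun t p =>
      fderiv_comp p (hdF _ _) (ih.diff t p)
    have hpair : Continuous fun q : ℝ × Pl => (cl (q.1 - N), isoExt S N q.1 q.2) :=
      (continuous_cl.comp (by fun_prop)).prodMk ih.cont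
    refine ⟨?_, ?_, ?_, ?_, ?_, ?_, ?_⟩
    · exact S.Ft_cont.comp_continuous hpair (fun q => ⟨cl_mem _, mem_univ _⟩)
    · intro t
      exact (hdF _).comp (ih.diff t)
    · simp only [hfd]
      exact (S.DFt_cont.comp_continuous hpair (fun q => ⟨cl_mem _, mem_univ _⟩)).clm_comp ih.dcont
    · intro t
      obtain ⟨G, -, hG, -⟩ := S.Ft_diffeo _ (cl_mem (t - N))
      exact hG.injective.comp (ih.inj t)
    · intro t p w h
      rw [hfd] at h
      obtain ⟨G, hGs, hG, -⟩ := S.Ft_diffeo _ (cl_mem (t - N))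
      apply ih.dinj t p
      set p' := isoExt S N t p
      have hc : fderiv ℝ (G ∘ S.Ft (cl (t - N))) p' =
          (fderiv ℝ G (S.Ft (cl (t - N)) p')).comp (fderiv ℝ (S.Ft (cl (t - N))) p') :=
        fderiv_comp p' (hGs.differentiable (by norm_num) _) (hdF _ _)
      rw [hG.comp_eq_id, fderiv_id] at hc
      have := congrArg (fun L : Pl →L[ℝ] Pl => L (fderiv ℝ (isoExt S N t) p w)) hc
      simp only [ContinuousLinearMap.comp_apply] at this h
      rw [h, map_zero] at this
      exact this
    · intro t p
      simp only [isoExt, ih.per, S.Ft_periodic]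
    · funext p
      have : cl (0 - (N:ℝ)) = 0 := cl_of_le (by simp)
      simp only [isoExt, this, ih.zero, S.Ft_zero, id]

lemma ext_ge (S : IsotopySetup) (N : ℕ) {t : ℝ} (h : (N:ℝ) ≤ t) : isoExt S N t = S.F^[N] := by
  induction N with
  | zero => rfl
  | succ N ih =>
    push_cast at h
    funext p
    rw [Function.iterate_succ_apply', ← ih (by linarith)]
    have : cl (t - N) = 1 := cl_of_ge (by linarith)
    simp only [isoExt, this, IsotopySetup.F]

lemma ext_eq (S : IsotopySetup) (M : ℕ) {t : ℝ} (h0 : 0 ≤ t) (h : t ≤ M) :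
    isoExt S M t = S.Ft (Int.fract t) ∘ S.F^[⌊t⌋₊] := by
  have hint : ∀ K : ℕ, S.Ft (Int.fract (K:ℝ)) ∘ S.F^[⌊(K:ℝ)⌋₊] = S.F^[K] := by
    intro K
    simp [S.Ft_zero]
  induction M with
  | zero =>
    have : t = ((0:ℕ):ℝ) := le_antisymm h (by simpa using h0)
    rw [this, hint]; rfl
  | succ N ih =>
    push_cast at h
    by_cases h1 : t ≤ N
    · rw [← ih h1]
      have : cl (t - N) = 0 := cl_of_le (by linarith)
      funext p
      simp only [isoExt, this, S.Ft_zero, id]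
    · have h1 := not_le.mp h1
      rcases h.eq_or_lt with h2 | h2
      · have : t = ((N + 1 : ℕ) : ℝ) := by push_cast; exact h2
        rw [ext_ge S (N + 1) this.ge, this, hint]
      · have hfl : ⌊t⌋₊ = N := (Nat.floor_eq_iff h0).mpr ⟨h1.le, h2⟩
        have hfr : Int.fract t = t - N := by
          rw [Int.fract_eq_iff]
          exact ⟨by linarith, by linarith, N, by simp⟩
        have : cl (t - N) = t - N := cl_of_mem (by linarith) (by linarith)
        rw [hfl, hfr]
        funext p
        simp only [isoExt, this, ext_ge S N h1.le, Function.comp]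

lemma F_diff (S : IsotopySetup) : Differentiable ℝ S.F :=
  (S.Ft_smooth 1 ⟨zero_le_one, le_rfl⟩).differentiable (by norm_num)

lemma D_eq (S : IsotopySetup) (M : ℕ) {t : ℝ} (h0 : 0 ≤ t) (h : t ≤ M) (p : Pl) :
    S.D t p = fderiv ℝ (isoExt S M t) p := by
  rw [ext_eq S M h0 h, IsotopySetup.D]
  refine (fderiv_comp p ?_ ?_).symm
  · exact (S.Ft_smooth _ ⟨Int.fract_nonneg _, (Int.fract_lt_one _).le⟩).differentiable
      (by norm_num) _
  · exact (F_diff S).iterate _ _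

lemma D_eq_chord (S : IsotopySetup) (M : ℕ) {t : ℝ} (h0 : 0 ≤ t) (h : t ≤ M) (p : Pl) :
    S.D t p vv = chord (isoExt S M) (t, p, 0, 0) := by
  rw [D_eq S M h0 h, chord_zero, ee_zero]; rfl

lemma angleVar_of (S : IsotopySetup) (M : ℕ) {Θ : Par → ℝ} (hc : Continuous Θ)
    (hd : ∀ q, Dir (chord (isoExt S M) q) (Θ q)) (h0 : ∀ p α s, Θ (0, p, α, s) = α) (p : Pl) :
    S.AngleVar p vv M (Θ (M, p, 0, 0)) := by
  refine ⟨fun t => Θ (t, p, 0, 0), Continuous.continuousOn (by fun_prop), ?_, by simp [h0]⟩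
  intro t ht
  rw [D_eq_chord S M ht.1 ht.2]
  exact hd _

lemma eq_of_angleVar (S : IsotopySetup) (n M : ℕ) (hnM : n ≤ M) {Θ : Par → ℝ} (hc : Continuous Θ)
    (hd : ∀ q, Dir (chord (isoExt S M) q) (Θ q)) (h0 : ∀ p α s, Θ (0, p, α, s) = α) {p : Pl} {a : ℝ}
    (ha : S.AngleVar p vv n a) : a = Θ (n, p, 0, 0) := by
  obtain ⟨θ, hθ, hdir, rfl⟩ := ha
  have hnM' : (n:ℝ) ≤ M := by exact_mod_cast hnM
  have := dir_const (isPreconnected_Icc (a := (0:ℝ)) (b := n)) (g := fun t => S.D t p vv)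
    (a := θ) (b := fun t => Θ (t, p, 0, 0)) hθ (Continuous.continuousOn (by fun_prop)) hdir
    (fun t ht => by
      rw [D_eq_chord S M ht.1 (ht.2.trans hnM')]
      exact hd _) (x := (n:ℝ)) (y := 0) (by simp) (by simp)
  simp only [h0] at this
  linarith

lemma conj_step (S : IsotopySetup) (htwist : S.PosTwist) (n : ℕ) (p : Pl)
    (h : S.AngleVar p vv n (-1/2)) : ∃ a, S.AngleVar p vv (n + 1) a ∧ a < -1/2 := by
  obtain ⟨Θ, hc, hd, h0, -⟩ := (good_ext S (n + 1)).exists_angle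
  obtain ⟨Θ₁, hc₁, hd₁, h0₁, h1₁⟩ := (good_ext S 1).exists_angle
  refine ⟨_, angleVar_of S (n + 1) hc hd h0 p, ?_⟩
  have e := eq_of_angleVar S n (n + 1) n.le_succ hc hd h0 h
  have hneg : Θ₁ (1, S.F^[n] p, 0, 0) < 0 := by
    refine (good_ext S 1).twist_neg hc₁ hd₁ h1₁ 1 ?_ _
    have : isoExt S 1 1 = S.F := by
      rw [ext_ge S 1 (by simp)]; rfl
    rw [this]
    exact htwist
  -- the vector after time `n`
  obtain ⟨c, hcpos, hvec⟩ := hd (n, p, 0, 0)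
  rw [← e, chord_zero, ee_zero] at hvec
  have hhalf : ee (-1/2) = -((0, 1) : Pl) := by
    have := ee_half 0
    rw [ee_zero] at this
    rw [← this]; norm_num
  rw [hhalf] at hvec
  have hFn : isoExt S (n + 1) n = S.F^[n] := by
    have : cl ((n:ℝ) - n) = 0 := cl_of_le (by simp)
    funext q
    simp only [isoExt, this, S.Ft_zero, id, ext_ge S n le_rfl]
  rw [hFn] at hvec
  have key := dir_const (isPreconnected_Icc (a := (n:ℝ)) (b := n + 1))
    (g := fun t => chord (isoExt S (n + 1)) (t, p, 0, 0))
    (a := fun t => Θ (t, p, 0, 0)) (b := fun t => Θ₁ (t - n, S.F^[n] p, 0, 0) - 1/2)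
    (Continuous.continuousOn (by fun_prop)) (Continuous.continuousOn (by fun_prop))
    (fun t _ => hd _) (fun t ht => by
      have hcomp : isoExt S (n + 1) t = isoExt S 1 (t - n) ∘ S.F^[n] := by
        funext q
        simp [isoExt, ext_ge S n ht.1]
      obtain ⟨r, hr, hr'⟩ := hd₁ (t - n, S.F^[n] p, 0, 0)
      rw [chord_zero, ee_zero] at hr'
      rw [chord_zero, ee_zero, hcomp, fderiv_comp p ((good_ext S 1).diff _ _)
        ((F_diff S).iterate _ _), ContinuousLinearMap.comp_apply, hvec, map_smul, map_neg, hr']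
      refine ⟨c * r, mul_pos hcpos hr, ?_⟩
      rw [ee_half, ← smul_neg, smul_smul])
    (x := (n:ℝ)) (y := n + 1) (by simp) (by simp)
  simp only [sub_self, h0₁, ← e, add_sub_cancel_left] at key
  push_cast
  linarith

/-- For a positive twist map `f`, there exists a point with conjugate points
if and only if there exists a point with over-conjugate points. -/
theorem statement6 (S : IsotopySetup) (htwist : S.PosTwist) :
    (∃ z : Ann, S.Conj z) ↔ (∃ z' : Ann, S.OverConj z') := by
  constructor
  · rintro ⟨z, p, hz, n, k, hn, hk, a, ha, rfl⟩
    refine ⟨z, p, hz, ?_⟩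
    rcases hk.eq_or_lt with h | h
    · subst h
      obtain ⟨b, hb, hb'⟩ := conj_step S htwist n p (by simpa using ha)
      exact ⟨n + 1, by omega, b, hb, hb'⟩
    · refine ⟨n, hn, _, ha, ?_⟩
      have : (2:ℝ) ≤ k := by exact_mod_cast h
      linarith
  · rintro ⟨z, p, hz, n, hn, a, ha, hlt⟩
    obtain ⟨Θ, hc, hd, h0, h1⟩ := (good_ext S n).exists_angle
    rw [eq_of_angleVar S n n le_rfl hc hd h0 ha] at hlt
    obtain ⟨q, hq⟩ := (good_ext S n).exists_large hc hd h0 h1 n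
    obtain ⟨w, -, hw⟩ := (isPreconnected_univ (α := Pl)).intermediate_value (mem_univ p)
      (mem_univ q) (f := fun q => Θ (n, q, 0, 0)) (Continuous.continuousOn (by fun_prop))
      (show (-1/2 : ℝ) ∈ _ from ⟨hlt.le, by linarith⟩)
    refine ⟨pr w, w, rfl, n, 1, hn, le_rfl, _, angleVar_of S n hc hd h0 w, ?_⟩
    simpa using hw

end
end

section
/- Let F : ℝ² → ℝ² be the lift of a positive twist map f : 𝔸 → 𝔸. Then the set C̃_F = {z ∈ ℝ² : p₁(F(z)) = p₁(z)} is the graph of a C¹ function Ψ₁ : ℝ → ℝ satisfying Ψ₁(x+1) = Ψ₁(x) for all x ∈ ℝ (i.e. C̃_F is the lift of the graph of a C¹ function ψ₁ : ℝ/ℤ → ℝ). -/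
noncomputable section

open MeasureTheory Set Filter Topology Function

/-- For a lift `F` of a positive twist map, the set
`C̃_F = {z ∈ ℝ² : p₁(F(z)) = p₁(z)}` is the graph of a `C¹` function `Ψ₁ : ℝ → ℝ` which is
`1`-periodic (hence lifts a `C¹` function `ψ₁ : ℝ/ℤ → ℝ`). -/
theorem statement8 (S : IsotopySetup) (htwist : S.PosTwist) :
    ∃ Ψ₁ : ℝ → ℝ, ContDiff ℝ 1 Ψ₁ ∧ (∀ x : ℝ, Ψ₁ (x + 1) = Ψ₁ x) ∧
      {p : Pl | (S.F p).1 = p.1} = {p : Pl | p.2 = Ψ₁ p.1} := by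
  have hF : ContDiff ℝ 1 S.F := S.Ft_smooth 1 (by simp)
  choose Ψ hΨ using fun x => (htwist x).2.1 x
  simp only at hΨ
  have huniq : ∀ x y, (S.F (x, y)).1 = x → y = Ψ x := fun x y h =>
    (htwist x).1.injective (by simp only [h, hΨ])
  refine ⟨Ψ, ?_, ?_, ?_⟩
  · rw [contDiff_iff_contDiffAt]
    intro x
    have hf : ContDiff ℝ 1 (fun p : Pl => (S.F p).1 - p.1) := by fun_prop
    have hc : ContDiffAt ℝ 1 (fun p : Pl => (S.F p).1 - p.1) (x, Ψ x) := hf.contDiffAt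
    have hinv : (fderiv ℝ (fun p : Pl => (S.F p).1 - p.1) (x, Ψ x) ∘L
        ContinuousLinearMap.inr ℝ ℝ ℝ).IsInvertible := by
      have h1 : HasFDerivAt (fun p : Pl => (S.F p).1 - p.1) _ (x, Ψ x) :=
        (hf.differentiable one_ne_zero _).hasFDerivAt
      have h2 : HasFDerivAt (fun y : ℝ => ((x, y) : Pl)) (ContinuousLinearMap.inr ℝ ℝ ℝ) (Ψ x) :=
        hasFDerivAt_prodMk_right x (Ψ x)
      have h3 := (h1.comp (Ψ x) h2).hasDerivAt
      set L := fderiv ℝ (fun p : Pl => (S.F p).1 - p.1) (x, Ψ x) ∘L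
        ContinuousLinearMap.inr ℝ ℝ ℝ with hL
      have h4 : HasDerivAt (fun y => (S.F (x, y)).1) (L 1) (Ψ x) := by
        refine (h3.add_const x).congr_of_eventuallyEq (Eventually.of_forall fun y => ?_)
        simp
      have h5 := (htwist x).2.2 (Ψ x)
      rw [h4.deriv] at h5
      have h6 : L 1 ≠ 0 := by
        exact h5.ne'
      refine ⟨ContinuousLinearEquiv.unitsEquivAut ℝ (Units.mk0 (L 1) h6), ?_⟩
      ext
      simp
    have hev := hc.eventually_apply_implicitFunction one_ne_zero hinv
    refine (hc.contDiffAt_implicitFunction one_ne_zero hinv).congr_of_eventuallyEq ?_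
    filter_upwards [hev] with y hy
    refine (huniq y _ ?_).symm
    have := hΨ x
    linarith
  · intro x
    refine (huniq (x + 1) (Ψ x) ?_).symm
    have h := S.Ft_periodic 1 (x, Ψ x)
    have h' : S.F (x + 1, Ψ x) = S.F (x, Ψ x) + (1, 0) := by simpa [IsotopySetup.F] using h
    rw [h']
    simp [hΨ]
  · ext ⟨x, y⟩
    simp only [mem_ofPred_eq]
    exact ⟨huniq x y, fun h => by rw [h, hΨ]⟩

end
end

section
/- Let f : 𝔸 → 𝔸 be a positive twist map with no conjugate points, with lift F : ℝ² → ℝ². Then for every n ≥ 1 and every x ∈ ℝ, the map y ↦ p₁(Fⁿ(x,y)) is an increasing diffeomorphism of ℝ onto ℝ (so fⁿ is a positive twist map), and the map y ↦ p₁(F⁻ⁿ(x,y)) is a decreasing diffeomorphism of ℝ onto ℝ (so f⁻ⁿ is a negative twist map). -/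
noncomputable section

open MeasureTheory Set Filter Topology Function

/-- The determinant of a linear endomorphism of the plane. -/
def det2 (A : Pl →L[ℝ] Pl) : ℝ :=
  (A (1, 0)).1 * (A (0, 1)).2 - (A (0, 1)).1 * (A (1, 0)).2

theorem apply_pl (A : Pl →L[ℝ] Pl) (v : Pl) : A v = v.1 • A (1, 0) + v.2 • A (0, 1) := by
  rw [← map_smul, ← map_smul, ← map_add]
  congr 1
  ext <;> simp

theorem det2_comp (A B : Pl →L[ℝ] Pl) : det2 (A.comp B) = det2 A * det2 B := by
  unfold det2
  simp only [ContinuousLinearMap.comp_apply]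
  rw [apply_pl A (B (1, 0)), apply_pl A (B (0, 1))]
  simp only [Prod.fst_add, Prod.snd_add, Prod.smul_fst, Prod.smul_snd, smul_eq_mul]
  ring

theorem det2_id : det2 (ContinuousLinearMap.id ℝ Pl) = 1 := by
  simp [det2]

theorem det2_continuous : Continuous det2 := by
  unfold det2
  fun_prop

/-- Chain rule for a right inverse. -/
theorem fderiv_comp_inv {F G : Pl → Pl} (hF : ContDiff ℝ 1 F) (hG : ContDiff ℝ 1 G)
    (h : Function.RightInverse G F) (q : Pl) :
    (fderiv ℝ F (G q)).comp (fderiv ℝ G q) = ContinuousLinearMap.id ℝ Pl := by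
  rw [← fderiv_comp q (hF.differentiable one_ne_zero _) (hG.differentiable one_ne_zero _)]
  rw [show F ∘ G = id from funext h, fderiv_id]

theorem hasDerivAt_fst {F : Pl → Pl} (hF : ContDiff ℝ 1 F) (x y : ℝ) :
    HasDerivAt (fun y : ℝ => (F (x, y)).1) ((fderiv ℝ F (x, y) (0, 1)).1) y := by
  have h1 : HasFDerivAt F (fderiv ℝ F (x, y)) (x, y) :=
    (hF.differentiable one_ne_zero _).hasFDerivAt
  have h2 : HasDerivAt (fun y : ℝ => ((x, y) : Pl)) (0, 1) y :=
    (hasDerivAt_const y x).prodMk (hasDerivAt_id y)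
  have h3 : HasDerivAt (fun y : ℝ => F (x, y)) (fderiv ℝ F (x, y) (0, 1)) y :=
    h1.comp_hasDerivAt y h2
  exact (hasFDerivAt_fst (𝕜 := ℝ) (p := F (x, y))).comp_hasDerivAt y h3

theorem inv_fst_neg {F G : Pl → Pl} (hF : ContDiff ℝ 1 F) (hG : ContDiff ℝ 1 G)
    (h : Function.RightInverse G F) (hdet : ∀ p, 0 < det2 (fderiv ℝ F p))
    (htw : ∀ p, 0 < (fderiv ℝ F p (0, 1)).1) (q : Pl) : (fderiv ℝ G q (0, 1)).1 < 0 := by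
  have h1 := fderiv_comp_inv hF hG h q
  have hd := hdet (G q)
  have ht := htw (G q)
  have h2 : fderiv ℝ F (G q) (fderiv ℝ G q (0, 1)) = (0, 1) := by
    rw [← ContinuousLinearMap.comp_apply, h1]; rfl
  rw [apply_pl] at h2
  unfold det2 at hd
  generalize fderiv ℝ F (G q) (1, 0) = a at *
  generalize fderiv ℝ F (G q) (0, 1) = b at *
  generalize fderiv ℝ G q (0, 1) = c at *
  have e1 := congrArg Prod.fst h2
  have e2 := congrArg Prod.snd h2
  simp only [Prod.fst_add, Prod.snd_add, Prod.smul_fst, Prod.smul_snd, smul_eq_mul] at e1 e2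
  have e3 : (a.1 * b.2 - b.1 * a.2) * c.1 = -b.1 := by
    linear_combination b.2 * e1 - b.1 * e2
  by_contra hc
  push Not at hc
  nlinarith [mul_nonneg hd.le hc]

theorem det_pos (S : IsotopySetup) (p : Pl) : 0 < det2 (fderiv ℝ S.F p) := by
  have hne : ∀ t ∈ Icc (0:ℝ) 1, det2 (fderiv ℝ (S.Ft t) p) ≠ 0 := by
    intro t ht h0
    obtain ⟨G, hG, hl, hr⟩ := S.Ft_diffeo t ht
    have h1 := fderiv_comp_inv (S.Ft_smooth t ht) hG hr (S.Ft t p)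
    rw [hl p] at h1
    have h2 := congrArg det2 h1
    rw [det2_comp, det2_id, h0] at h2
    simp at h2
  have hc : ContinuousOn (fun t : ℝ => det2 (fderiv ℝ (S.Ft t) p)) (Icc 0 1) := by
    refine det2_continuous.comp_continuousOn ?_
    exact S.DFt_cont.comp (f := fun t : ℝ => (t, p)) (by fun_prop) (fun t ht => ⟨ht, mem_univ _⟩)
  have h0 : det2 (fderiv ℝ (S.Ft 0) p) = 1 := by
    rw [S.Ft_zero, fderiv_id, det2_id]
  by_contra hneg
  push Not at hneg
  have := intermediate_value_Icc' zero_le_one hc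
  obtain ⟨t, ht, h⟩ := this (show (0:ℝ) ∈ Icc _ _ from ⟨hneg, by rw [h0]; exact zero_le_one⟩)
  exact hne t ht h

theorem iter_contDiff {F : Pl → Pl} (hF : ContDiff ℝ 1 F) (n : ℕ) : ContDiff ℝ 1 (F^[n]) := by
  induction n with
  | zero => exact contDiff_id
  | succ n ih => rw [Function.iterate_succ]; exact ih.comp hF

theorem iter_det {F : Pl → Pl} (hF : ContDiff ℝ 1 F) (hd : ∀ p, 0 < det2 (fderiv ℝ F p)) (n : ℕ) :
    ∀ p, 0 < det2 (fderiv ℝ (F^[n]) p) := by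
  induction n with
  | zero => intro p; rw [Function.iterate_zero, fderiv_id, det2_id]; exact one_pos
  | succ n ih =>
    intro p
    rw [Function.iterate_succ, fderiv_comp p ((iter_contDiff hF n).differentiable one_ne_zero _)
      (hF.differentiable one_ne_zero _), det2_comp]
    exact mul_pos (ih _) (hd _)

theorem iter_periodic {F : Pl → Pl} (h : ∀ p : Pl, F (p + (1, 0)) = F p + (1, 0)) (n : ℕ) :
    ∀ p : Pl, F^[n] (p + (1, 0)) = F^[n] p + (1, 0) := by
  induction n with
  | zero => intro p; rfl
  | succ n ih => intro p; rw [Function.iterate_succ_apply, h, ih, ← Function.iterate_succ_apply]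

/-- The image of a vertical line moves down when its base abscissa increases. -/
theorem twist_order {F G : Pl → Pl} (hF : ContDiff ℝ 1 F) (hG : ContDiff ℝ 1 G)
    (hl : Function.LeftInverse G F)
    (h : Function.RightInverse G F) (hdet : ∀ p, 0 < det2 (fderiv ℝ F p))
    (htw : ∀ p, 0 < (fderiv ℝ F p (0, 1)).1) {p q : Pl} (hpq : p.1 < q.1)
    (he : (F p).1 = (F q).1) : (F q).2 < (F p).2 := by
  have hanti : StrictAnti (fun y : ℝ => (G ((F p).1, y)).1) := by
    apply strictAnti_of_deriv_neg
    intro y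
    rw [(hasDerivAt_fst hG _ y).deriv]
    exact inv_fst_neg hF hG h hdet htw _
  apply hanti.lt_iff_gt.mp
  show (G ((F p).1, (F p).2)).1 < (G ((F p).1, (F q).2)).1
  conv_rhs => rw [he]
  rw [Prod.mk.eta, Prod.mk.eta, hl, hl]
  exact hpq

theorem iter_twist {F G : Pl → Pl} (hF : ContDiff ℝ 1 F) (hG : ContDiff ℝ 1 G)
    (hl : Function.LeftInverse G F)
    (hr : Function.RightInverse G F) (hper : ∀ p : Pl, F (p + (1, 0)) = F p + (1, 0))
    (hdet : ∀ p, 0 < det2 (fderiv ℝ F p))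
    (htw : ∀ p, 0 < (fderiv ℝ F p (0, 1)).1)
    (hsurj : ∀ x : ℝ, Function.Surjective (fun y : ℝ => (F (x, y)).1))
    (hnc : ∀ p : Pl, ∀ n : ℕ, 1 ≤ n → ((fderiv ℝ (F^[n]) p) (0, 1)).1 ≠ 0) (n : ℕ) :
    (∀ p, 0 < (fderiv ℝ (F^[n + 1]) p (0, 1)).1) ∧
      ∀ x : ℝ, Function.Surjective (fun y : ℝ => (F^[n + 1] (x, y)).1) := by
  induction n with
  | zero => exact ⟨htw, hsurj⟩
  | succ n ih =>
    obtain ⟨ih1, ih2⟩ := ih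
    have mono1 : ∀ x, StrictMono (fun y : ℝ => (F (x, y)).1) := fun x => by
      apply strictMono_of_deriv_pos
      intro y
      rw [(hasDerivAt_fst hF x y).deriv]; exact htw _
    have monoN : ∀ x, StrictMono (fun y : ℝ => (F^[n + 1] (x, y)).1) := fun x => by
      apply strictMono_of_deriv_pos
      intro y
      rw [(hasDerivAt_fst (iter_contDiff hF (n + 1)) x y).deriv]; exact ih1 _
    have hC := iter_contDiff hF (n + 1 + 1)
    -- comparison of two points one turn apart on the image of a vertical line
    have key : ∀ x y y' : ℝ, (F (x, y')).1 + 1 = (F (x, y)).1 →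
        (F^[n + 1 + 1] (x, y')).1 + 1 < (F^[n + 1 + 1] (x, y)).1 := by
      intro x y y' h
      have hs : F (x + 1, y') = F (x, y') + (1, 0) := by
        rw [← hper]; simp
      have hlt : (F (x + 1, y')).2 < (F (x, y)).2 :=
        twist_order hF hG hl hr hdet htw (p := (x, y)) (q := (x + 1, y')) (by simp)
          (by rw [hs]; simp [← h])
      have h1 : (F^[n + 1 + 1] (x, y')).1 + 1 = (F^[n + 1] (F (x + 1, y'))).1 := by
        rw [hs, iter_periodic hper, Function.iterate_succ_apply F (n + 1)]; rfl
      rw [h1, Function.iterate_succ_apply F (n + 1)]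
      have h2 : (F (x + 1, y')).1 = (F (x, y)).1 := by rw [hs, ← h]; rfl
      have h3 := monoN (F (x, y)).1 hlt
      simp only [Prod.mk.eta] at h3
      rw [← h2, Prod.mk.eta] at h3
      exact h3
    constructor
    · rintro ⟨x, y⟩
      by_contra hneg
      push Not at hneg
      have hall := hasDerivWithinAt_forall_lt_or_forall_gt_of_forall_ne (s := univ)
        (f := fun y : ℝ => (F^[n + 1 + 1] (x, y)).1)
        (f' := fun y : ℝ => (fderiv ℝ (F^[n + 1 + 1]) (x, y) (0, 1)).1) (m := 0)
        convex_univ (fun y _ => (hasDerivAt_fst hC x y).hasDerivWithinAt)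
        (fun y _ => hnc _ _ (by omega))
      rcases hall with hall | hall
      · have hanti : StrictAnti (fun y : ℝ => (F^[n + 1 + 1] (x, y)).1) := by
          apply strictAnti_of_deriv_neg
          intro y
          rw [(hasDerivAt_fst hC x y).deriv]; exact hall y (mem_univ _)
        obtain ⟨y', hy'⟩ := hsurj x ((F (x, y)).1 - 1)
        have hy'' : (F (x, y')).1 = (F (x, y)).1 - 1 := hy'
        have h1 := key x y y' (by rw [hy'']; ring)
        have h2 : y' < y := (mono1 x).lt_iff_lt.mp (show (F (x, y')).1 < (F (x, y)).1 by linarith)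
        have h3 : (F^[n + 1 + 1] (x, y)).1 < (F^[n + 1 + 1] (x, y')).1 := hanti h2
        linarith
      · exact absurd (hall y (mem_univ _)) (not_lt.mpr hneg)
    · intro x
      choose Y hY using hsurj x
      have hY' : ∀ u, (F (x, Y u)).1 = u := hY
      have hstep : ∀ u, (F^[n + 1 + 1] (x, Y u)).1 + 1 < (F^[n + 1 + 1] (x, Y (u + 1))).1 :=
        fun u => key x _ _ (by rw [hY', hY'])
      have hup : ∀ k : ℕ, (F^[n + 1 + 1] (x, Y 0)).1 + k ≤ (F^[n + 1 + 1] (x, Y k)).1 := by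
        intro k
        induction k with
        | zero => simp
        | succ k ihk => have := hstep k; push_cast; linarith
      have hdown : ∀ k : ℕ, (F^[n + 1 + 1] (x, Y (-k))).1 ≤ (F^[n + 1 + 1] (x, Y 0)).1 - k := by
        intro k
        induction k with
        | zero => simp
        | succ k ihk =>
          have := hstep (-((k + 1 : ℕ) : ℝ))
          rw [show -((k + 1 : ℕ) : ℝ) + 1 = -(k : ℝ) by push_cast; ring] at this
          push_cast at *; linarith
      have hcont : Continuous (fun y : ℝ => (F^[n + 1 + 1] (x, y)).1) :=
        continuous_iff_continuousAt.mpr fun y => (hasDerivAt_fst hC x y).continuousAt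
      intro c
      obtain ⟨k, hk⟩ := exists_nat_ge |c - (F^[n + 1 + 1] (x, Y 0)).1|
      have hk' := abs_le.mp hk
      exact mem_range_of_exists_le_of_exists_ge hcont
        ⟨Y (-k), (hdown k).trans (by linarith)⟩ ⟨Y k, le_trans (by linarith) (hup k)⟩

/-- If a positive twist map `f` has no conjugate points, then for every
`n ≥ 1`, `fⁿ` is a positive twist map (each `y ↦ p₁(Fⁿ(x,y))` is an increasing diffeomorphism
of `ℝ` onto `ℝ`) and `f⁻ⁿ` is a negative twist map (each `y ↦ p₁(F⁻ⁿ(x,y))` is a decreasing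
diffeomorphism of `ℝ` onto `ℝ`). -/
theorem statement9 (S : IsotopySetup) (htwist : S.PosTwist) (hnc : S.NoConjPts) :
    ∀ n : ℕ, 1 ≤ n → ∀ x : ℝ,
      (StrictMono (fun y : ℝ => (S.F^[n] (x, y)).1) ∧
        Function.Surjective (fun y : ℝ => (S.F^[n] (x, y)).1) ∧
        ∀ y : ℝ, 0 < deriv (fun y : ℝ => (S.F^[n] (x, y)).1) y) ∧
      (StrictAnti (fun y : ℝ => ((Function.invFun S.F)^[n] (x, y)).1) ∧
        Function.Surjective (fun y : ℝ => ((Function.invFun S.F)^[n] (x, y)).1) ∧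
        ∀ y : ℝ, deriv (fun y : ℝ => ((Function.invFun S.F)^[n] (x, y)).1) y < 0) := by
  have h1mem : (1:ℝ) ∈ Icc (0:ℝ) 1 := ⟨zero_le_one, le_refl _⟩
  have hF : ContDiff ℝ 1 S.F := S.Ft_smooth 1 h1mem
  obtain ⟨G, hG, hl', hr'⟩ := S.Ft_diffeo 1 h1mem
  have hl : Function.LeftInverse G S.F := hl'
  have hr : Function.RightInverse G S.F := hr'
  have hinv : Function.invFun S.F = G := by
    funext q
    apply hl.injective
    rw [hr q]
    exact Function.invFun_eq ⟨G q, hr q⟩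
  have htw : ∀ p, 0 < (fderiv ℝ S.F p (0, 1)).1 := by
    rintro ⟨x, y⟩
    rw [← (hasDerivAt_fst hF x y).deriv]
    exact (htwist x).2.2 y
  intro n hn x
  obtain ⟨m, rfl⟩ : ∃ m, n = m + 1 := ⟨n - 1, by omega⟩
  rw [hinv]
  obtain ⟨hpos, hsurj⟩ := iter_twist hF hG hl hr (S.Ft_periodic 1) (det_pos S) htw
    (fun x => (htwist x).2.1) hnc m
  have hFn := iter_contDiff hF (m + 1)
  have hGn := iter_contDiff hG (m + 1)
  have hrn : Function.RightInverse G^[m + 1] S.F^[m + 1] := hr.iterate _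
  have hln : Function.LeftInverse G^[m + 1] S.F^[m + 1] := hl.iterate _
  have hd1 : ∀ y : ℝ, 0 < deriv (fun y : ℝ => (S.F^[m + 1] (x, y)).1) y := by
    intro y
    rw [(hasDerivAt_fst hFn x y).deriv]; exact hpos _
  have hd2 : ∀ y : ℝ, deriv (fun y : ℝ => (G^[m + 1] (x, y)).1) y < 0 := by
    intro y
    rw [(hasDerivAt_fst hGn x y).deriv]
    exact inv_fst_neg hFn hGn hrn (iter_det hF (det_pos S) _) hpos _
  refine ⟨⟨strictMono_of_deriv_pos hd1, hsurj x, hd1⟩, strictAnti_of_deriv_neg hd2, ?_, hd2⟩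
  intro u
  obtain ⟨y, hy⟩ := hsurj u x
  have hy' : (S.F^[m + 1] (u, y)).1 = x := hy
  refine ⟨(S.F^[m + 1] (u, y)).2, ?_⟩
  show (G^[m + 1] (x, _)).1 = u
  rw [← hy', Prod.mk.eta, hln]

end
end
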